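/- arXiv:2208.03925 — 10 statements merged into one kernel-verified Lean document; each statement's English description precedes it below -/
import Mathlib

section
/- Normal-proof completeness of the Dual Data Calculus DDC: for every valid dual datum δ there exists a normal proof of δ in DDC, i.e. a purely synthetic DDC-deduction of δ from the empty dual datum ⊤; moreover such a proof exists that uses only synthetic G-rules and the rule EM (in particular, without any use of the synthetic S-rule Exp). -/
/-- Formulas of classical propositional logic: propositional variables,
negation, conjunction, disjunction. -/
inductive Fml : Type
  | var : ℕ → Fml
  | neg : Fml → Fml
  | conj : Fml → Fml → Fml
  | disj : Fml → Fml → Fml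
  deriving DecidableEq

/-- A datum: a finite set of finite sets (components) of formulas. -/
abbrev Datum := Finset (Finset Fml)

/-- Truth-value of a formula under an interpretation of the variables. -/
def Fml.eval (v : ℕ → Bool) : Fml → Bool
  | .var n => v n
  | .neg A => !A.eval v
  | .conj A B => A.eval v && B.eval v
  | .disj A B => A.eval v || B.eval v

/-- An interpretation verifies a datum iff some component has all its
formulas true. -/
def Verifies (v : ℕ → Bool) (α : Datum) : Prop :=
  ∃ Γ ∈ α, ∀ A ∈ Γ, A.eval v = true

/-- A dual datum: again a finite set of finite sets (components) of formulas. -/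
abbrev DualDatum := Finset (Finset Fml)

/-- An interpretation verifies a dual datum iff every component contains at
least one true formula. -/
def DVerifies (v : ℕ → Bool) (δ : DualDatum) : Prop :=
  ∀ Γ ∈ δ, ∃ A ∈ Γ, A.eval v = true

/-- The analytic G-rules of the Dual Data Calculus DDC. -/
inductive DualGStep : DualDatum → DualDatum → Prop
  | disj (Γ : Finset Fml) (A B : Fml) (ρ : DualDatum) :
      DualGStep (insert (insert (Fml.disj A B) Γ) ρ)
                (insert (insert A (insert B Γ)) ρ)
  | conj (Γ : Finset Fml) (A B : Fml) (ρ : DualDatum) :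
      DualGStep (insert (insert (Fml.conj A B) Γ) ρ)
                (insert (insert A Γ) (insert (insert B Γ) ρ))
  | negneg (Γ : Finset Fml) (A : Fml) (ρ : DualDatum) :
      DualGStep (insert (insert (Fml.neg (Fml.neg A)) Γ) ρ)
                (insert (insert A Γ) ρ)
  | negconj (Γ : Finset Fml) (A B : Fml) (ρ : DualDatum) :
      DualGStep (insert (insert (Fml.neg (Fml.conj A B)) Γ) ρ)
                (insert (insert (Fml.neg A) (insert (Fml.neg B) Γ)) ρ)
  | negdisj (Γ : Finset Fml) (A B : Fml) (ρ : DualDatum) :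
      DualGStep (insert (insert (Fml.neg (Fml.disj A B)) Γ) ρ)
                (insert (insert (Fml.neg A) Γ) (insert (insert (Fml.neg B) Γ) ρ))

/-- The synthetic N-rule EM of DDC: add a component containing a pair A, ¬A
(possibly together with further formulas). -/
def DualEMStep (α β : DualDatum) : Prop :=
  ∃ (Γ : Finset Fml) (A : Fml),
    β = insert (insert A (insert (Fml.neg A) Γ)) α

/-- The analytic N-rule NC of DDC: replace the components Γ∪{A}, Γ∪{¬A}
by the component Γ. -/
def DualNCStep (α β : DualDatum) : Prop :=
  ∃ (Γ : Finset Fml) (A : Fml) (ρ : DualDatum),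
    α = insert (insert A Γ) (insert (insert (Fml.neg A) Γ) ρ) ∧
    β = insert Γ ρ

/-- The synthetic S-rule Exp of DDC: replace a component Γ by a superset Γ∪Δ. -/
def DualExpStep (α β : DualDatum) : Prop :=
  ∃ (Γ Δ : Finset Fml) (ρ : DualDatum),
    α = insert Γ ρ ∧ β = insert (Γ ∪ Δ) ρ

/-- The analytic S-rule Del of DDC: delete a component. -/
def DualDelStep (α β : DualDatum) : Prop :=
  ∃ Γ : Finset Fml, α = insert Γ β

def Fml.wt : Fml → ℕ
  | .var _ => 1
  | .neg A => A.wt + 1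
  | .conj A B => A.wt + B.wt + 2
  | .disj A B => A.wt + B.wt + 2

def cwt (Γ : Finset Fml) : ℕ := ∑ A ∈ Γ, A.wt

theorem cwt_insert_le (A : Fml) (Γ : Finset Fml) : cwt (insert A Γ) ≤ A.wt + cwt Γ := by
  unfold cwt
  by_cases h : A ∈ Γ
  · rw [Finset.insert_eq_of_mem h]; omega
  · rw [Finset.sum_insert h]

theorem cwt_erase (A : Fml) (Γ : Finset Fml) (h : A ∈ Γ) :
    A.wt + cwt (Γ.erase A) = cwt Γ := by
  unfold cwt
  exact Finset.add_sum_erase Γ Fml.wt h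

def CValid (Γ : Finset Fml) : Prop := ∀ v : ℕ → Bool, ∃ A ∈ Γ, A.eval v = true

theorem cvalid_split {Γ : Finset Fml} {C : Fml} (hC : C ∈ Γ) (hv : CValid Γ)
    (Δ : Finset Fml) (hs : Γ.erase C ⊆ Δ)
    (hΔ : ∀ v, C.eval v = true → ∃ A ∈ Δ, A.eval v = true) : CValid Δ := by
  intro v
  obtain ⟨A, hA, hAv⟩ := hv v
  by_cases h : A = C
  · subst h; exact hΔ v hAv
  · exact ⟨A, hs (Finset.mem_erase.2 ⟨h, hA⟩), hAv⟩

theorem add_component (n : ℕ) : ∀ (Γ : Finset Fml), cwt Γ < n → CValid Γ → ∀ ρ : DualDatum,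
    Relation.ReflTransGen (fun x y => DualGStep y x ∨ DualEMStep x y) ρ (insert Γ ρ) := by
  induction n with
  | zero => intro Γ h; omega
  | succ n ih =>
    intro Γ hn hv ρ
    by_cases h1 : ∃ A B, Fml.disj A B ∈ Γ
    · obtain ⟨A, B, h⟩ := h1
      have hw := cwt_erase _ _ h
      have i1 := cwt_insert_le B (Γ.erase (Fml.disj A B))
      have i2 := cwt_insert_le A (insert B (Γ.erase (Fml.disj A B)))
      simp only [Fml.wt] at hw
      refine (ih (insert A (insert B (Γ.erase (Fml.disj A B)))) (by omega) ?_ ρ).tail (Or.inl ?_)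
      · refine cvalid_split h hv _ (fun x hx => by simp [Finset.mem_erase.1 hx]) ?_
        intro v; simp only [Fml.eval, Bool.or_eq_true]
        rintro (h | h)
        · exact ⟨A, by simp, h⟩
        · exact ⟨B, by simp, h⟩
      · have := DualGStep.disj (Γ.erase (Fml.disj A B)) A B ρ
        rwa [Finset.insert_erase h] at this
    by_cases h2 : ∃ A B, Fml.neg (Fml.conj A B) ∈ Γ
    · obtain ⟨A, B, h⟩ := h2
      have hw := cwt_erase _ _ h
      have i1 := cwt_insert_le B.neg (Γ.erase (Fml.conj A B).neg)
      have i2 := cwt_insert_le A.neg (insert B.neg (Γ.erase (Fml.conj A B).neg))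
      simp only [Fml.wt] at hw i1 i2
      refine (ih (insert A.neg (insert B.neg (Γ.erase (Fml.conj A B).neg))) (by omega) ?_ ρ).tail
        (Or.inl ?_)
      · refine cvalid_split h hv _ (fun x hx => by simp [Finset.mem_erase.1 hx]) ?_
        intro v; simp only [Fml.eval, Bool.not_and, Bool.or_eq_true]
        rintro (h | h)
        · exact ⟨A.neg, by simp, h⟩
        · exact ⟨B.neg, by simp, h⟩
      · have := DualGStep.negconj (Γ.erase (Fml.conj A B).neg) A B ρ
        rwa [Finset.insert_erase h] at this
    by_cases h3 : ∃ A, Fml.neg (Fml.neg A) ∈ Γ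
    · obtain ⟨A, h⟩ := h3
      have hw := cwt_erase _ _ h
      have i1 := cwt_insert_le A (Γ.erase A.neg.neg)
      simp only [Fml.wt] at hw i1
      refine (ih (insert A (Γ.erase A.neg.neg)) (by omega) ?_ ρ).tail (Or.inl ?_)
      · refine cvalid_split h hv _ (fun x hx => by simp [Finset.mem_erase.1 hx]) ?_
        intro v; simp only [Fml.eval, Bool.not_not]
        intro h
        exact ⟨A, by simp, h⟩
      · have := DualGStep.negneg (Γ.erase A.neg.neg) A ρ
        rwa [Finset.insert_erase h] at this
    by_cases h4 : ∃ A B, Fml.conj A B ∈ Γ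
    · obtain ⟨A, B, h⟩ := h4
      have hw := cwt_erase _ _ h
      have i1 := cwt_insert_le A (Γ.erase (Fml.conj A B))
      have i2 := cwt_insert_le B (Γ.erase (Fml.conj A B))
      simp only [Fml.wt] at hw
      refine ((ih (insert B (Γ.erase (Fml.conj A B))) (by omega) ?_ ρ).trans
        (ih (insert A (Γ.erase (Fml.conj A B))) (by omega) ?_ _)).tail (Or.inl ?_)
      · refine cvalid_split h hv _ (fun x hx => by simp [Finset.mem_erase.1 hx]) ?_
        intro v; simp only [Fml.eval, Bool.and_eq_true]
        exact fun h => ⟨B, by simp, h.2⟩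
      · refine cvalid_split h hv _ (fun x hx => by simp [Finset.mem_erase.1 hx]) ?_
        intro v; simp only [Fml.eval, Bool.and_eq_true]
        exact fun h => ⟨A, by simp, h.1⟩
      · have := DualGStep.conj (Γ.erase (Fml.conj A B)) A B ρ
        rwa [Finset.insert_erase h] at this
    by_cases h5 : ∃ A B, Fml.neg (Fml.disj A B) ∈ Γ
    · obtain ⟨A, B, h⟩ := h5
      have hw := cwt_erase _ _ h
      have i1 := cwt_insert_le A.neg (Γ.erase (Fml.disj A B).neg)
      have i2 := cwt_insert_le B.neg (Γ.erase (Fml.disj A B).neg)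
      simp only [Fml.wt] at hw i1 i2
      refine ((ih (insert B.neg (Γ.erase (Fml.disj A B).neg)) (by omega) ?_ ρ).trans
        (ih (insert A.neg (Γ.erase (Fml.disj A B).neg)) (by omega) ?_ _)).tail (Or.inl ?_)
      · refine cvalid_split h hv _ (fun x hx => by simp [Finset.mem_erase.1 hx]) ?_
        intro v; simp only [Fml.eval, Bool.not_or, Bool.and_eq_true]
        exact fun h => ⟨B.neg, by simp, h.2⟩
      · refine cvalid_split h hv _ (fun x hx => by simp [Finset.mem_erase.1 hx]) ?_
        intro v; simp only [Fml.eval, Bool.not_or, Bool.and_eq_true]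
        exact fun h => ⟨A.neg, by simp, h.1⟩
      · have := DualGStep.negdisj (Γ.erase (Fml.disj A B).neg) A B ρ
        rwa [Finset.insert_erase h] at this
    obtain ⟨C, hC, hCv⟩ := hv (fun n => decide (Fml.neg (Fml.var n) ∈ Γ))
    match C, hC, hCv with
    | .var m, hC, hCv =>
      simp only [Fml.eval, decide_eq_true_eq] at hCv
      refine Relation.ReflTransGen.single (Or.inr ⟨Γ, .var m, ?_⟩)
      rw [Finset.insert_eq_of_mem hCv, Finset.insert_eq_of_mem hC]
    | .neg (.var m), hC, hCv => simp [Fml.eval, hC] at hCv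
    | .neg (.neg A), hC, _ => exact absurd ⟨A, hC⟩ h3
    | .neg (.conj A B), hC, _ => exact absurd ⟨A, B, hC⟩ h2
    | .neg (.disj A B), hC, _ => exact absurd ⟨A, B, hC⟩ h5
    | .conj A B, hC, _ => exact absurd ⟨A, B, hC⟩ h4
    | .disj A B, hC, _ => exact absurd ⟨A, B, hC⟩ h1

theorem ddc_aux (δ : DualDatum) : (∀ Γ ∈ δ, CValid Γ) →
    Relation.ReflTransGen
      (fun x y => DualGStep y x ∨ DualEMStep x y)
      (∅ : DualDatum) δ := by
  induction δ using Finset.induction_on with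
  | empty => intro _; exact .refl
  | insert Γ ρ _ ih =>
    intro h
    exact (ih (fun Δ hΔ => h Δ (Finset.mem_insert_of_mem hΔ))).trans
      (add_component _ Γ (Nat.lt_succ_self _) (h Γ (Finset.mem_insert_self _ _)) ρ)

/-- Normal-proof completeness of DDC: every valid dual datum δ has a purely
synthetic proof (a deduction from the empty dual datum ⊤ by synthetic rules
only); moreover it has one using only synthetic G-rules and EM
(in particular without the synthetic S-rule Exp). -/
theorem ddc_normal_proof_completeness (δ : DualDatum)
    (h : ∀ v : ℕ → Bool, DVerifies v δ) :
    Relation.ReflTransGen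
      (fun x y => DualGStep y x ∨ DualEMStep x y ∨ DualExpStep x y)
      (∅ : DualDatum) δ ∧
    Relation.ReflTransGen
      (fun x y => DualGStep y x ∨ DualEMStep x y)
      (∅ : DualDatum) δ := by
  have key := ddc_aux δ (fun Γ hΓ v => h v Γ hΓ)
  exact ⟨Relation.ReflTransGen.mono (fun _ _ hs => hs.elim Or.inl (fun e => Or.inr (Or.inl e))) _ _ key, key⟩
end

section
/- Normal-deduction completeness of the Hybrid Calculus HC: if the datum α implies the dual datum δ (every interpretation verifying α verifies δ), then there exists a normal HC-deduction of δ from α, namely a purely analytic DC-deduction starting from α, followed by a single application of the Criss-Crossing rule passing from a datum to a dual datum, followed by a purely synthetic DDC-deduction ending in δ; moreover such a deduction exists using no S-rules other than Criss-Crossing. -/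
/-- The analytic G-rules of the Data Calculus DC. -/
inductive GStep : Datum → Datum → Prop
  | conj (Γ : Finset Fml) (A B : Fml) (ρ : Datum) :
      GStep (insert (insert (Fml.conj A B) Γ) ρ)
            (insert (insert A (insert B Γ)) ρ)
  | disj (Γ : Finset Fml) (A B : Fml) (ρ : Datum) :
      GStep (insert (insert (Fml.disj A B) Γ) ρ)
            (insert (insert A Γ) (insert (insert B Γ) ρ))
  | negneg (Γ : Finset Fml) (A : Fml) (ρ : Datum) :
      GStep (insert (insert (Fml.neg (Fml.neg A)) Γ) ρ)
            (insert (insert A Γ) ρ)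
  | negdisj (Γ : Finset Fml) (A B : Fml) (ρ : Datum) :
      GStep (insert (insert (Fml.neg (Fml.disj A B)) Γ) ρ)
            (insert (insert (Fml.neg A) (insert (Fml.neg B) Γ)) ρ)
  | negconj (Γ : Finset Fml) (A B : Fml) (ρ : Datum) :
      GStep (insert (insert (Fml.neg (Fml.conj A B)) Γ) ρ)
            (insert (insert (Fml.neg A) Γ) (insert (insert (Fml.neg B) Γ) ρ))

/-- The analytic N-rule NC: delete a component containing a pair A, ¬A. -/
def NCStep (α β : Datum) : Prop :=
  ∃ (Γ : Finset Fml) (A : Fml),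
    α = insert (insert A (insert (Fml.neg A) Γ)) β

/-- The synthetic N-rule EM: replace a component Γ by the two components
Γ∪{A} and Γ∪{¬A}. -/
def EMStep (α β : Datum) : Prop :=
  ∃ (Γ : Finset Fml) (A : Fml) (ρ : Datum),
    α = insert Γ ρ ∧
    β = insert (insert A Γ) (insert (insert (Fml.neg A) Γ) ρ)

/-- The analytic S-rule Del: replace a component Γ∪Δ by its subset Γ. -/
def DelStep (α β : Datum) : Prop :=
  ∃ (Γ Δ : Finset Fml) (ρ : Datum),
    α = insert (Γ ∪ Δ) ρ ∧ β = insert Γ ρ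

/-- The synthetic S-rule Exp: add an arbitrary new component. -/
def ExpStep (α β : Datum) : Prop :=
  ∃ Γ : Finset Fml, β = insert Γ α

/-- The Criss-Crossing rule: a dual datum δ may be inferred from a datum β
provided every component of β shares a formula with every component of δ. -/
def CrissCross (β : Datum) (δ : DualDatum) : Prop :=
  ∀ Γ ∈ β, ∀ Δ ∈ δ, ∃ A, A ∈ Γ ∧ A ∈ Δ

def Fml.sz : Fml → ℕ
  | .var _ => 1
  | .neg A => A.sz + 1
  | .conj A B => A.sz + B.sz + 2
  | .disj A B => A.sz + B.sz + 2

theorem Fml.sz_pos (A : Fml) : 0 < A.sz := by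
  cases A <;> simp [Fml.sz]

def Fml.IsLit : Fml → Prop
  | .var _ => True
  | .neg (.var _) => True
  | _ => False

def cm (Γ : Finset Fml) : ℕ := ∑ A ∈ Γ, A.sz

theorem cm_insert_le (A : Fml) (Γ : Finset Fml) : cm (insert A Γ) ≤ A.sz + cm Γ := by
  unfold cm
  by_cases h : A ∈ Γ
  · rw [Finset.insert_eq_of_mem h]; omega
  · rw [Finset.sum_insert h]

theorem cm_erase (A : Fml) (Γ : Finset Fml) (h : A ∈ Γ) : cm (Γ.erase A) + A.sz = cm Γ :=
  Finset.sum_erase_add _ _ h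

/-- Every non-literal can be decomposed by `R`, with sign `b`. -/
def Decomp (R : Datum → Datum → Prop) (b : Bool) (F : Fml) : Prop :=
  (∃ A B : Fml, (A = B ∧ A.sz < F.sz ∨ A.sz + B.sz < F.sz) ∧
    (∀ v, A.eval v = b → B.eval v = b → F.eval v = b) ∧
    ∀ Γ ρ, R (insert (insert F Γ) ρ) (insert (insert A (insert B Γ)) ρ)) ∨
  (∃ A B : Fml, A.sz < F.sz ∧ B.sz < F.sz ∧
    (∀ v, A.eval v = b → F.eval v = b) ∧ (∀ v, B.eval v = b → F.eval v = b) ∧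
    ∀ Γ ρ, R (insert (insert F Γ) ρ) (insert (insert A Γ) (insert (insert B Γ) ρ)))

def Clean (Γ : Finset Fml) : Prop :=
  (∀ A ∈ Γ, A.IsLit) ∧ ∀ A ∈ Γ, Fml.neg A ∉ Γ

theorem reduce_comp (R : Datum → Datum → Prop) (b : Bool)
    (hG : ∀ F : Fml, ¬ F.IsLit → Decomp R b F)
    (hN : ∀ Γ A ρ, R (insert (insert A (insert (Fml.neg A) Γ)) ρ) ρ) :
    ∀ (n : ℕ) (Γ : Finset Fml), cm Γ < n → ∃ D : Datum,
      (∀ ρ, Relation.ReflTransGen R (insert Γ ρ) (D ∪ ρ)) ∧ (∀ Δ ∈ D, Clean Δ) ∧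
      ∀ v, ∀ Δ ∈ D, (∀ A ∈ Δ, A.eval v = b) → ∀ A ∈ Γ, A.eval v = b := by
  intro n
  induction n with
  | zero => intro Γ h; omega
  | succ n ih =>
    intro Γ hΓ
    by_cases hl : ∀ A ∈ Γ, A.IsLit
    · by_cases hc : ∀ A ∈ Γ, Fml.neg A ∉ Γ
      · refine ⟨{Γ}, fun ρ => ?_, ?_, ?_⟩
        · rw [← Finset.insert_eq]
        · simpa using ⟨hl, hc⟩
        · simp
      · push Not at hc
        obtain ⟨A, hA, hA'⟩ := hc
        refine ⟨∅, fun ρ => ?_, by simp, by simp⟩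
        have := hN Γ A ρ
        rw [Finset.insert_eq_of_mem hA', Finset.insert_eq_of_mem hA] at this
        simpa using Relation.ReflTransGen.single this
    · push Not at hl
      obtain ⟨F, hF, hFl⟩ := hl
      have e := cm_erase F Γ hF
      have hins : insert F (Γ.erase F) = Γ := Finset.insert_erase hF
      generalize Γ.erase F = Γ' at e hins
      subst hins
      rcases hG F hFl with ⟨A, B, hs, hv, hR⟩ | ⟨A, B, hA, hB, hvA, hvB, hR⟩
      · have hm : cm (insert A (insert B Γ')) < n := by
          rcases hs with ⟨rfl, hs⟩ | hs
          · rw [Finset.insert_idem]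
            have := cm_insert_le A Γ'
            omega
          · have := cm_insert_le A (insert B Γ')
            have := cm_insert_le B Γ'
            omega
        obtain ⟨D, h1, h2, h3⟩ := ih _ hm
        refine ⟨D, fun ρ => .head (hR _ _) (h1 ρ), h2, ?_⟩
        intro v Δ hΔ hall
        have := h3 v Δ hΔ hall
        simp only [Finset.forall_mem_insert] at this ⊢
        exact ⟨hv v this.1 this.2.1, this.2.2⟩
      · have := cm_insert_le A Γ'
        have := cm_insert_le B Γ'
        obtain ⟨D, h1, h2, h3⟩ := ih (insert A Γ') (by omega)
        obtain ⟨D', h1', h2', h3'⟩ := ih (insert B Γ') (by omega)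
        refine ⟨D' ∪ D, fun ρ => .head (hR _ _) ((h1 _).trans ?_), ?_, ?_⟩
        · rw [Finset.union_insert, Finset.union_assoc]
          exact h1' _
        · intro Δ hΔ
          rcases Finset.mem_union.1 hΔ with h | h
          · exact h2' _ h
          · exact h2 _ h
        · intro v Δ hΔ hall
          rcases Finset.mem_union.1 hΔ with h | h
          · have := h3' v Δ h hall
            simp only [Finset.forall_mem_insert] at this ⊢
            exact ⟨hvB v this.1, this.2⟩
          · have := h3 v Δ h hall
            simp only [Finset.forall_mem_insert] at this ⊢
            exact ⟨hvA v this.1, this.2⟩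

theorem reduce_datum (R : Datum → Datum → Prop) (b : Bool)
    (hG : ∀ F : Fml, ¬ F.IsLit → Decomp R b F)
    (hN : ∀ Γ A ρ, R (insert (insert A (insert (Fml.neg A) Γ)) ρ) ρ) (α : Datum) :
    ∃ D : Datum,
      (∀ ρ, Relation.ReflTransGen R (α ∪ ρ) (D ∪ ρ)) ∧ (∀ Δ ∈ D, Clean Δ) ∧
      ∀ v, ∀ Δ ∈ D, (∀ A ∈ Δ, A.eval v = b) → ∃ Γ ∈ α, ∀ A ∈ Γ, A.eval v = b := by
  induction α using Finset.induction_on with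
  | empty => exact ⟨∅, fun ρ => .refl, by simp, by simp⟩
  | insert Γ α _ ih =>
    obtain ⟨D, h1, h2, h3⟩ := ih
    obtain ⟨D', h1', h2', h3'⟩ := reduce_comp R b hG hN _ Γ (Nat.lt_succ_self _)
    refine ⟨D ∪ D', fun ρ => ?_, ?_, ?_⟩
    · rw [Finset.insert_union]
      refine (h1' _).trans ?_
      rw [Finset.union_left_comm, Finset.union_assoc]
      exact h1 _
    · intro Δ hΔ
      rcases Finset.mem_union.1 hΔ with h | h
      · exact h2 _ h
      · exact h2' _ h
    · intro v Δ hΔ hall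
      rcases Finset.mem_union.1 hΔ with h | h
      · obtain ⟨Γ', hΓ', h'⟩ := h3 v Δ h hall
        exact ⟨Γ', Finset.mem_insert_of_mem hΓ', h'⟩
      · exact ⟨Γ, Finset.mem_insert_self _ _, h3' v Δ h hall⟩

theorem decomp_G (F : Fml) (h : ¬ F.IsLit) :
    Decomp (fun x y => GStep x y ∨ NCStep x y) true F := by
  match F, h with
  | .var _, h => exact absurd trivial h
  | .neg (.var _), h => exact absurd trivial h
  | .neg (.neg A), _ =>
    refine .inl ⟨A, A, .inl ⟨rfl, by simp [Fml.sz]⟩, by simp [Fml.eval], fun Γ ρ => .inl ?_⟩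
    rw [Finset.insert_idem]; exact .negneg _ _ _
  | .neg (.conj A B), _ =>
    exact .inr ⟨.neg A, .neg B, by simp [Fml.sz]; omega, by simp [Fml.sz]; omega,
      by simp +contextual [Fml.eval], by simp +contextual [Fml.eval],
      fun Γ ρ => .inl (.negconj _ _ _ _)⟩
  | .neg (.disj A B), _ =>
    exact .inl ⟨.neg A, .neg B, .inr (by simp [Fml.sz]; omega),
      by simp +contextual [Fml.eval], fun Γ ρ => .inl (.negdisj _ _ _ _)⟩
  | .conj A B, _ =>
    exact .inl ⟨A, B, .inr (by simp [Fml.sz]),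
      by simp +contextual [Fml.eval], fun Γ ρ => .inl (.conj _ _ _ _)⟩
  | .disj A B, _ =>
    exact .inr ⟨A, B, by simp [Fml.sz]; omega, by simp [Fml.sz]; omega,
      by simp +contextual [Fml.eval], by simp +contextual [Fml.eval],
      fun Γ ρ => .inl (.disj _ _ _ _)⟩

theorem decomp_D (F : Fml) (h : ¬ F.IsLit) :
    Decomp (fun x y => DualGStep x y ∨ DualEMStep y x) false F := by
  match F, h with
  | .var _, h => exact absurd trivial h
  | .neg (.var _), h => exact absurd trivial h
  | .neg (.neg A), _ =>
    refine .inl ⟨A, A, .inl ⟨rfl, by simp [Fml.sz]⟩, by simp [Fml.eval], fun Γ ρ => .inl ?_⟩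
    rw [Finset.insert_idem]; exact .negneg _ _ _
  | .neg (.disj A B), _ =>
    exact .inr ⟨.neg A, .neg B, by simp [Fml.sz]; omega, by simp [Fml.sz]; omega,
      by simp +contextual [Fml.eval], by simp +contextual [Fml.eval],
      fun Γ ρ => .inl (.negdisj _ _ _ _)⟩
  | .neg (.conj A B), _ =>
    exact .inl ⟨.neg A, .neg B, .inr (by simp [Fml.sz]; omega),
      by simp +contextual [Fml.eval], fun Γ ρ => .inl (.negconj _ _ _ _)⟩
  | .disj A B, _ =>
    exact .inl ⟨A, B, .inr (by simp [Fml.sz]),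
      by simp +contextual [Fml.eval], fun Γ ρ => .inl (.disj _ _ _ _)⟩
  | .conj A B, _ =>
    exact .inr ⟨A, B, by simp [Fml.sz]; omega, by simp [Fml.sz]; omega,
      by simp +contextual [Fml.eval], by simp +contextual [Fml.eval],
      fun Γ ρ => .inl (.conj _ _ _ _)⟩

theorem separate (Γ Δ : Finset Fml) (hΓ : Clean Γ) (hΔ : Clean Δ)
    (hd : ¬ ∃ A, A ∈ Γ ∧ A ∈ Δ) :
    ∃ v, (∀ A ∈ Γ, A.eval v = true) ∧ (∀ A ∈ Δ, A.eval v = false) := by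
  refine ⟨fun n => decide (Fml.var n ∈ Γ ∨ Fml.neg (.var n) ∈ Δ), ?_, ?_⟩
  · intro A hA
    match A, hΓ.1 A hA with
    | .var n, _ => simp [Fml.eval, hA]
    | .neg (.var n), _ =>
      have h1 : Fml.var n ∉ Γ := fun h => hΓ.2 _ h hA
      have h2 : Fml.neg (.var n) ∉ Δ := fun h => hd ⟨_, hA, h⟩
      simp [Fml.eval, h1, h2]
  · intro A hA
    match A, hΔ.1 A hA with
    | .var n, _ =>
      have h1 : Fml.var n ∉ Γ := fun h => hd ⟨_, h, hA⟩
      have h2 : Fml.neg (.var n) ∉ Δ := fun h => hΔ.2 _ hA h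
      simp [Fml.eval, h1, h2]
    | .neg (.var n), _ => simp [Fml.eval, hA]

/-- Normal-deduction completeness of the Hybrid Calculus HC: if the datum α
implies the dual datum δ, then there is a normal HC-deduction of δ from α
(a purely analytic DC-part, one Criss-Crossing step, a purely synthetic
DDC-part); moreover there is such a deduction using no S-rules other than
Criss-Crossing. -/
theorem hc_normal_deduction_completeness (α : Datum) (δ : DualDatum)
    (h : ∀ v : ℕ → Bool, Verifies v α → DVerifies v δ) :
    (∃ (β : Datum) (ε : DualDatum),
      Relation.ReflTransGen (fun x y => GStep x y ∨ NCStep x y ∨ DelStep x y)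
        α β ∧
      CrissCross β ε ∧
      Relation.ReflTransGen
        (fun x y => DualGStep y x ∨ DualEMStep x y ∨ DualExpStep x y) ε δ) ∧
    (∃ (β : Datum) (ε : DualDatum),
      Relation.ReflTransGen (fun x y => GStep x y ∨ NCStep x y) α β ∧
      CrissCross β ε ∧
      Relation.ReflTransGen
        (fun x y => DualGStep y x ∨ DualEMStep x y) ε δ) := by
  have key : ∃ (β : Datum) (ε : DualDatum),
      Relation.ReflTransGen (fun x y => GStep x y ∨ NCStep x y) α β ∧
      CrissCross β ε ∧
      Relation.ReflTransGen
        (fun x y => DualGStep y x ∨ DualEMStep x y) ε δ := by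
    obtain ⟨β, b1, b2, b3⟩ := reduce_datum _ true decomp_G
      (fun Γ A ρ => .inr ⟨Γ, A, rfl⟩) α
    obtain ⟨ε, e1, e2, e3⟩ := reduce_datum _ false decomp_D
      (fun Γ A ρ => .inr ⟨Γ, A, rfl⟩) δ
    refine ⟨β, ε, by simpa using b1 ∅, ?_, ?_⟩
    · intro Γ hΓ Δ hΔ
      by_contra hd
      obtain ⟨v, hv1, hv2⟩ := separate Γ Δ (b2 _ hΓ) (e2 _ hΔ) hd
      obtain ⟨Δ', hΔ', hf⟩ := e3 v Δ hΔ hv2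
      obtain ⟨A, hA, hAt⟩ := h v (b3 v Γ hΓ hv1) Δ' hΔ'
      rw [hf A hA] at hAt
      exact absurd hAt (by simp)
    · have := (e1 ∅).swap
      simpa [Function.swap] using this
  refine ⟨?_, key⟩
  obtain ⟨β, ε, h1, h2, h3⟩ := key
  exact ⟨β, ε, Relation.ReflTransGen.mono (fun _ _ h => h.imp_right .inl) _ _ h1, h2,
    Relation.ReflTransGen.mono (fun _ _ h => h.imp_right .inl) _ _ h3⟩
end

section
/- Directional Interpolation for DC: if α ⊨ β (every interpretation verifying α verifies β) then there exists a datum γ such that the set of propositional variables occurring in γ is contained in the intersection of the sets of propositional variables occurring in α and in β, γ is deducible from α by a purely analytic DC-deduction, and β is deducible from γ by a quasi-synthetic DC-deduction (one using only synthetic rules and S-rules). -/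
/-- The set of propositional variables occurring in a formula. -/
def Fml.vars : Fml → Finset ℕ
  | .var n => {n}
  | .neg A => A.vars
  | .conj A B => A.vars ∪ B.vars
  | .disj A B => A.vars ∪ B.vars

/-- The set of propositional variables occurring in a datum. -/
def DatumVars (α : Datum) : Finset ℕ :=
  α.sup fun Γ => Γ.sup Fml.vars

abbrev AStar : Datum → Datum → Prop :=
  Relation.ReflTransGen (fun x y => GStep x y ∨ NCStep x y ∨ DelStep x y)

abbrev QStar : Datum → Datum → Prop :=
  Relation.ReflTransGen (fun x y => GStep y x ∨ EMStep x y ∨ DelStep x y ∨ ExpStep x y)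

theorem eval_congr' (v w : ℕ → Bool) (A : Fml) (h : ∀ n ∈ A.vars, v n = w n) :
    A.eval v = A.eval w := by
  induction A with
  | var n => exact h n (by simp [Fml.vars])
  | neg A ih => simp only [Fml.eval]; rw [ih h]
  | conj A B ihA ihB =>
    simp only [Fml.eval]
    rw [ihA fun n hn => h n (by simp [Fml.vars, hn]), ihB fun n hn => h n (by simp [Fml.vars, hn])]
  | disj A B ihA ihB =>
    simp only [Fml.eval]
    rw [ihA fun n hn => h n (by simp [Fml.vars, hn]), ihB fun n hn => h n (by simp [Fml.vars, hn])]

theorem vars_sub {α : Datum} {Γ : Finset Fml} {A : Fml} (hΓ : Γ ∈ α) (hA : A ∈ Γ) :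
    A.vars ⊆ DatumVars α := by
  have h1 : A.vars ≤ Γ.sup Fml.vars := Finset.le_sup (f := Fml.vars) hA
  have h2 : Γ.sup Fml.vars ≤ DatumVars α :=
    Finset.le_sup (f := fun Γ : Finset Fml => Γ.sup Fml.vars) hΓ
  exact h1.trans h2

theorem verifies_congr (v w : ℕ → Bool) (β : Datum) (h : ∀ n ∈ DatumVars β, v n = w n)
    (hv : Verifies v β) : Verifies w β := by
  obtain ⟨Γ, hΓ, hA⟩ := hv
  refine ⟨Γ, hΓ, fun A hAm => ?_⟩
  rw [← hA A hAm]
  exact (eval_congr' v w A fun n hn => h n (vars_sub hΓ hAm hn)).symm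

def LitSat (v : ℕ → Bool) (Γ : Finset Fml) : Prop :=
  ∀ n, (Fml.var n ∈ Γ → v n = true) ∧ (Fml.neg (Fml.var n) ∈ Γ → v n = false)

theorem LitSat.mono {v : ℕ → Bool} {Γ Δ : Finset Fml} (h : LitSat v Δ) (hs : Γ ⊆ Δ) :
    LitSat v Γ := fun n => ⟨fun x => (h n).1 (hs x), fun x => (h n).2 (hs x)⟩

/-- Γ can be absorbed into β quasi-synthetically. -/
def PGood (β : Datum) (Γ : Finset Fml) : Prop := ∀ ρ : Datum, QStar (insert Γ ρ) (ρ ∪ β)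

theorem qexp (ρ σ : Datum) : QStar ρ (ρ ∪ σ) := by
  induction σ using Finset.induction_on with
  | empty => simpa using Relation.ReflTransGen.refl
  | insert Γ σ _ ih =>
    refine ih.tail (Or.inr (Or.inr (Or.inr ⟨Γ, ?_⟩)))
    rw [Finset.union_insert]

theorem pgood_del {β : Datum} {Γ Δ : Finset Fml} (hΓ : Γ ∈ β) (hs : Γ ⊆ Δ) : PGood β Δ := by
  intro ρ
  have h1 : QStar (insert Δ ρ) (insert Γ ρ) :=
    Relation.ReflTransGen.single
      (Or.inr (Or.inr (Or.inl ⟨Γ, Δ, ρ, by rw [Finset.union_eq_right.2 hs], rfl⟩)))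
  have h2 := h1.trans (qexp (insert Γ ρ) β)
  rwa [Finset.insert_union, Finset.insert_eq_of_mem (Finset.mem_union_right _ hΓ)] at h2

theorem pgood_em {β : Datum} {Γ : Finset Fml} (A : Fml) (h1 : PGood β (insert A Γ))
    (h2 : PGood β (insert (Fml.neg A) Γ)) : PGood β Γ := by
  intro ρ
  refine Relation.ReflTransGen.head (Or.inr (Or.inl ⟨Γ, A, ρ, rfl, rfl⟩)) ?_
  refine (h1 _).trans ?_
  rw [Finset.insert_union]
  have := h2 (ρ ∪ β)
  rwa [Finset.union_assoc, Finset.union_self] at this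

theorem pgood_all {β : Datum} (S : Datum) (h : ∀ Γ ∈ S, PGood β Γ) :
    ∀ ρ, QStar (S ∪ ρ) (ρ ∪ β) := by
  induction S using Finset.induction_on with
  | empty => intro ρ; rw [Finset.empty_union]; exact qexp ρ β
  | insert Γ S _ ih =>
    intro ρ
    rw [Finset.insert_union]
    refine (h Γ (by simp) _).trans ?_
    rw [Finset.union_assoc]
    have := ih (fun Γ hΓ => h Γ (by simp [hΓ])) (ρ ∪ β)
    rwa [Finset.union_assoc, Finset.union_self] at this

/-- one-component quasi-synthetic transformation -/
def QTo (Γ Δ : Finset Fml) : Prop := ∀ ρ : Datum, QStar (insert Γ ρ) (insert Δ ρ)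

theorem QTo.one {Γ Δ : Finset Fml} (h : ∀ ρ : Datum, GStep (insert Δ ρ) (insert Γ ρ)) :
    QTo Γ Δ := fun ρ => Relation.ReflTransGen.single (Or.inl (h ρ))

theorem QTo.two {Γ Δ E : Finset Fml}
    (h : ∀ ρ : Datum, GStep (insert Δ ρ) (insert E (insert Γ ρ))) :
    QTo Γ Δ := fun ρ => Relation.ReflTransGen.head (Or.inr (Or.inr (Or.inr ⟨E, rfl⟩)))
      (Relation.ReflTransGen.single (Or.inl (h ρ)))

theorem QTo.conj {Γ : Finset Fml} {A B : Fml} (hA : A ∈ Γ) (hB : B ∈ Γ) :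
    QTo Γ (insert (A.conj B) Γ) := QTo.one fun ρ => by
  have := GStep.conj Γ A B ρ
  rwa [Finset.insert_eq_of_mem hB, Finset.insert_eq_of_mem hA] at this

theorem QTo.negdisj {Γ : Finset Fml} {A B : Fml} (hA : A.neg ∈ Γ) (hB : B.neg ∈ Γ) :
    QTo Γ (insert (A.disj B).neg Γ) := QTo.one fun ρ => by
  have := GStep.negdisj Γ A B ρ
  rwa [Finset.insert_eq_of_mem hB, Finset.insert_eq_of_mem hA] at this

theorem QTo.negneg {Γ : Finset Fml} {A : Fml} (hA : A ∈ Γ) :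
    QTo Γ (insert A.neg.neg Γ) := QTo.one fun ρ => by
  have := GStep.negneg Γ A ρ
  rwa [Finset.insert_eq_of_mem hA] at this

theorem QTo.disjl {Γ : Finset Fml} {A B : Fml} (hA : A ∈ Γ) :
    QTo Γ (insert (A.disj B) Γ) := QTo.two (E := insert B Γ) fun ρ => by
  have := GStep.disj Γ A B ρ
  rwa [Finset.insert_eq_of_mem hA, Finset.insert_comm] at this

theorem QTo.disjr {Γ : Finset Fml} {A B : Fml} (hB : B ∈ Γ) :
    QTo Γ (insert (A.disj B) Γ) := QTo.two (E := insert A Γ) fun ρ => by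
  have := GStep.disj Γ A B ρ
  rwa [Finset.insert_eq_of_mem hB] at this

theorem QTo.negconjl {Γ : Finset Fml} {A B : Fml} (hA : A.neg ∈ Γ) :
    QTo Γ (insert (A.conj B).neg Γ) := QTo.two (E := insert B.neg Γ) fun ρ => by
  have := GStep.negconj Γ A B ρ
  rwa [Finset.insert_eq_of_mem hA, Finset.insert_comm] at this

theorem QTo.negconjr {Γ : Finset Fml} {A B : Fml} (hB : B.neg ∈ Γ) :
    QTo Γ (insert (A.conj B).neg Γ) := QTo.two (E := insert A.neg Γ) fun ρ => by
  have := GStep.negconj Γ A B ρ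
  rwa [Finset.insert_eq_of_mem hB] at this

theorem pgood_of_qto {β : Datum} {Γ Δ : Finset Fml} (h : QTo Γ Δ) (hΔ : PGood β Δ) :
    PGood β Γ := fun ρ => (h ρ).trans (hΔ ρ)

theorem pgood_synth (β : Datum) (v : ℕ → Bool) (A : Fml) : ∀ Γ : Finset Fml,
    (∀ n ∈ A.vars, (v n = true → Fml.var n ∈ Γ) ∧ (v n = false → (Fml.var n).neg ∈ Γ)) →
    (A.eval v = true → (∀ Δ, Γ ⊆ Δ → A ∈ Δ → PGood β Δ) → PGood β Γ) ∧
    (A.eval v = false → (∀ Δ, Γ ⊆ Δ → A.neg ∈ Δ → PGood β Δ) → PGood β Γ) := by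
  have fin : ∀ {Γ Δ : Finset Fml} {C : Fml}, Γ ⊆ Δ → QTo Δ (insert C Δ) →
      (∀ Δ, Γ ⊆ Δ → C ∈ Δ → PGood β Δ) → PGood β Δ := fun hs hq hk =>
    pgood_of_qto hq (hk _ (hs.trans (Finset.subset_insert _ _)) (Finset.mem_insert_self _ _))
  induction A with
  | var n =>
    intro Γ h
    have h := h n (by simp [Fml.vars])
    exact ⟨fun hv hk => hk Γ subset_rfl (h.1 hv), fun hv hk => hk Γ subset_rfl (h.2 hv)⟩
  | neg A ih =>
    intro Γ h
    have := ih Γ h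
    refine ⟨fun hv hk => this.2 (by simpa [Fml.eval] using hv) hk,
      fun hv hk => this.1 (by simpa [Fml.eval] using hv) fun Δ hs hA =>
        fin hs (QTo.negneg hA) hk⟩
  | conj A B ihA ihB =>
    intro Γ h
    have hA : ∀ n ∈ A.vars, _ := fun n hn => h n (by simp [Fml.vars, hn])
    have hB : ∀ n ∈ B.vars, _ := fun n hn => h n (by simp [Fml.vars, hn])
    constructor
    · intro hv hk
      simp only [Fml.eval, Bool.and_eq_true] at hv
      refine (ihA Γ hA).1 hv.1 fun Δ hs hAm => ?_
      refine (ihB Δ fun n hn => ⟨fun x => hs ((hB n hn).1 x), fun x => hs ((hB n hn).2 x)⟩).1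
        hv.2 fun Δ' hs' hBm => ?_
      exact fin (hs.trans hs') (QTo.conj (hs' hAm) hBm) hk
    · intro hv hk
      simp only [Fml.eval, Bool.and_eq_false_iff] at hv
      rcases hv with hv | hv
      · exact (ihA Γ hA).2 hv fun Δ hs hm => fin hs (QTo.negconjl hm) hk
      · exact (ihB Γ hB).2 hv fun Δ hs hm => fin hs (QTo.negconjr hm) hk
  | disj A B ihA ihB =>
    intro Γ h
    have hA : ∀ n ∈ A.vars, _ := fun n hn => h n (by simp [Fml.vars, hn])
    have hB : ∀ n ∈ B.vars, _ := fun n hn => h n (by simp [Fml.vars, hn])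
    constructor
    · intro hv hk
      simp only [Fml.eval, Bool.or_eq_true] at hv
      rcases hv with hv | hv
      · exact (ihA Γ hA).1 hv fun Δ hs hm => fin hs (QTo.disjl hm) hk
      · exact (ihB Γ hB).1 hv fun Δ hs hm => fin hs (QTo.disjr hm) hk
    · intro hv hk
      simp only [Fml.eval, Bool.or_eq_false_iff] at hv
      refine (ihA Γ hA).2 hv.1 fun Δ hs hAm => ?_
      refine (ihB Δ fun n hn => ⟨fun x => hs ((hB n hn).1 x), fun x => hs ((hB n hn).2 x)⟩).2
        hv.2 fun Δ' hs' hBm => ?_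
      exact fin (hs.trans hs') (QTo.negdisj (hs' hAm) hBm) hk

theorem pgood_synth_all (β : Datum) (v : ℕ → Bool) (S : Finset Fml) : ∀ Γ : Finset Fml,
    (∀ A ∈ S, ∀ n ∈ A.vars,
      (v n = true → Fml.var n ∈ Γ) ∧ (v n = false → (Fml.var n).neg ∈ Γ)) →
    (∀ A ∈ S, A.eval v = true) → (∀ Δ, Γ ⊆ Δ → S ⊆ Δ → PGood β Δ) → PGood β Γ := by
  induction S using Finset.induction_on with
  | empty => intro Γ _ _ hk; exact hk Γ subset_rfl (by simp)
  | insert A S _ ih =>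
    intro Γ h hv hk
    refine (pgood_synth β v A Γ (h A (by simp))).1 (hv A (by simp)) fun Δ hs hm => ?_
    refine ih Δ (fun B hB n hn => ?_) (fun B hB => hv B (by simp [hB])) fun Δ' hs' hS => ?_
    · have := h B (by simp [hB]) n hn
      exact ⟨fun x => hs (this.1 x), fun x => hs (this.2 x)⟩
    · exact hk Δ' (hs.trans hs') (Finset.insert_subset (hs' hm) hS)

theorem pgood_complete (β : Datum) (W : Finset ℕ) : ∀ Γ : Finset Fml,
    (∀ n ∈ DatumVars β, n ∈ W ∨ Fml.var n ∈ Γ ∨ (Fml.var n).neg ∈ Γ) →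
    (∃ v, LitSat v Γ) → (∀ v, LitSat v Γ → Verifies v β) → PGood β Γ := by
  induction W using Finset.induction_on with
  | empty =>
    intro Γ h ⟨v, hv⟩ hb
    obtain ⟨S, hS, hSv⟩ := hb v hv
    refine pgood_synth_all β v S Γ (fun A hA n hn => ?_) hSv fun Δ _ hs => pgood_del hS hs
    have h1 := h n (vars_sub hS hA hn)
    have h2 := hv n
    constructor
    · intro hvn
      rcases h1 with h1 | h1 | h1
      · simp at h1
      · exact h1
      · simp [h2.2 h1] at hvn
    · intro hvn
      rcases h1 with h1 | h1 | h1
      · simp at h1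
      · simp [h2.1 h1] at hvn
      · exact h1
  | insert m W _ ih =>
    intro Γ h ⟨v, hv⟩ hb
    by_cases hp : Fml.var m ∈ Γ
    · refine ih Γ (fun n hn => ?_) ⟨v, hv⟩ hb
      rcases h n hn with h1 | h1
      · rcases Finset.mem_insert.1 h1 with rfl | h1
        · exact Or.inr (Or.inl hp)
        · exact Or.inl h1
      · exact Or.inr h1
    by_cases hq : (Fml.var m).neg ∈ Γ
    · refine ih Γ (fun n hn => ?_) ⟨v, hv⟩ hb
      rcases h n hn with h1 | h1
      · rcases Finset.mem_insert.1 h1 with rfl | h1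
        · exact Or.inr (Or.inr hq)
        · exact Or.inl h1
      · exact Or.inr h1
    refine pgood_em (Fml.var m) ?_ ?_
    · refine ih _ (fun n hn => ?_) ⟨Function.update v m true, fun n => ?_⟩
        fun w hw => hb w (hw.mono (Finset.subset_insert _ _))
      · have := h n hn
        simp only [Finset.mem_insert, Fml.var.injEq] at this ⊢
        tauto
      · by_cases hn : n = m
        · subst hn; simp [hq]
        · simpa [Function.update_of_ne hn, hn] using hv n
    · refine ih _ (fun n hn => ?_) ⟨Function.update v m false, fun n => ?_⟩
        fun w hw => hb w (hw.mono (Finset.subset_insert _ _))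
      · have := h n hn
        simp only [Finset.mem_insert, Fml.var.injEq, Fml.neg.injEq] at this ⊢
        tauto
      · by_cases hn : n = m
        · subst hn; simp [hp]
        · simpa [Function.update_of_ne hn, hn] using hv n

/-- Γ can be replaced analytically by good components. -/
def AGood (V : Finset ℕ) (β : Datum) (Γ : Finset Fml) : Prop :=
  ∃ γ : Datum, (∀ Λ ∈ γ, (∀ A ∈ Λ, A.vars ⊆ V ∩ DatumVars β) ∧ PGood β Λ) ∧
    ∀ ρ, AStar (insert Γ ρ) (ρ ∪ γ)

theorem agood_one {V : Finset ℕ} {β : Datum} {Γ Δ : Finset Fml}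
    (h : ∀ ρ : Datum, GStep (insert Γ ρ) (insert Δ ρ)) (hΔ : AGood V β Δ) : AGood V β Γ := by
  obtain ⟨γ, h1, h2⟩ := hΔ
  exact ⟨γ, h1, fun ρ => Relation.ReflTransGen.head (Or.inl (h ρ)) (h2 ρ)⟩

theorem agood_two {V : Finset ℕ} {β : Datum} {Γ Δ E : Finset Fml}
    (h : ∀ ρ : Datum, GStep (insert Γ ρ) (insert Δ (insert E ρ)))
    (hΔ : AGood V β Δ) (hE : AGood V β E) : AGood V β Γ := by
  obtain ⟨γ, h1, h2⟩ := hΔ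
  obtain ⟨γ', h1', h2'⟩ := hE
  refine ⟨γ ∪ γ', fun Λ hΛ => (Finset.mem_union.1 hΛ).elim (h1 Λ) (h1' Λ), fun ρ => ?_⟩
  refine Relation.ReflTransGen.head (Or.inl (h ρ)) ((h2 _).trans ?_)
  rw [Finset.insert_union, ← Finset.union_assoc]
  exact h2' _

def Ent (Γ : Finset Fml) (A : Fml) : Prop := ∀ v, LitSat v Γ → A.eval v = true

def VarsIn (V : Finset ℕ) (Γ : Finset Fml) : Prop := ∀ A ∈ Γ, A.vars ⊆ V

theorem VarsIn.ins {V : Finset ℕ} {Γ : Finset Fml} {A : Fml} (h : VarsIn V Γ)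
    (hA : A.vars ⊆ V) : VarsIn V (insert A Γ) := by
  intro B hB
  rcases Finset.mem_insert.1 hB with rfl | hB
  · exact hA
  · exact h B hB

theorem Ent.mono {Γ Δ : Finset Fml} {A : Fml} (h : Ent Γ A) (hs : Γ ⊆ Δ) : Ent Δ A :=
  fun v hv => h v (hv.mono hs)

theorem agood_decomp (V : Finset ℕ) (β : Datum) (A : Fml) : ∀ Γ : Finset Fml, VarsIn V Γ →
    (A ∈ Γ → (∀ Δ, Γ ⊆ Δ → VarsIn V Δ → Ent Δ A → AGood V β Δ) → AGood V β Γ) ∧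
    (A.neg ∈ Γ → (∀ Δ, Γ ⊆ Δ → VarsIn V Δ → Ent Δ A.neg → AGood V β Δ) → AGood V β Γ) := by
  induction A with
  | var n =>
    intro Γ hV
    exact ⟨fun hm hk => hk Γ subset_rfl hV fun v hv => (hv n).1 hm,
      fun hm hk => hk Γ subset_rfl hV fun v hv => by simp [Fml.eval, (hv n).2 hm]⟩
  | neg A ih =>
    intro Γ hV
    refine ⟨fun hm hk => (ih Γ hV).2 hm hk, fun hm hk => ?_⟩
    refine agood_one (Δ := insert A Γ) (fun ρ => ?_) ?_
    · have := GStep.negneg Γ A ρ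
      rwa [Finset.insert_eq_of_mem hm] at this
    · refine (ih _ (hV.ins (A := A) (hV A.neg.neg hm))).1 (by simp) fun Δ hs hVΔ he => ?_
      refine hk Δ ((Finset.subset_insert _ _).trans hs) hVΔ fun v hv => ?_
      simp [Fml.eval, he v hv]
  | conj A B ihA ihB =>
    intro Γ hV
    constructor
    · intro hm hk
      have hvv := hV _ hm
      simp only [Fml.vars, Finset.union_subset_iff] at hvv
      refine agood_one (Δ := insert A (insert B Γ)) (fun ρ => ?_) ?_
      · have := GStep.conj Γ A B ρ
        rwa [Finset.insert_eq_of_mem hm] at this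
      refine (ihA _ ((hV.ins hvv.2).ins hvv.1)).1 (by simp) fun Δ hs hVΔ he => ?_
      refine (ihB Δ hVΔ).1 (hs (by simp)) fun Δ' hs' hVΔ' he' => ?_
      refine hk Δ' (fun x hx => hs' (hs (by simp [hx]))) hVΔ' fun v hv => ?_
      simp [Fml.eval, he.mono hs' v hv, he' v hv]
    · intro hm hk
      have hvv := hV _ hm
      simp only [Fml.vars, Finset.union_subset_iff] at hvv
      refine agood_two (Δ := insert A.neg Γ) (E := insert B.neg Γ) (fun ρ => ?_) ?_ ?_
      · have := GStep.negconj Γ A B ρ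
        rwa [Finset.insert_eq_of_mem hm] at this
      · refine (ihA _ (hV.ins (A := A.neg) hvv.1)).2 (by simp) fun Δ hs hVΔ he => ?_
        refine hk Δ (fun x hx => hs (by simp [hx])) hVΔ fun v hv => ?_
        have := he v hv
        simp_all [Fml.eval]
      · refine (ihB _ (hV.ins (A := B.neg) hvv.2)).2 (by simp) fun Δ hs hVΔ he => ?_
        refine hk Δ (fun x hx => hs (by simp [hx])) hVΔ fun v hv => ?_
        have := he v hv
        simp_all [Fml.eval]
  | disj A B ihA ihB =>
    intro Γ hV
    constructor
    · intro hm hk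
      have hvv := hV _ hm
      simp only [Fml.vars, Finset.union_subset_iff] at hvv
      refine agood_two (Δ := insert A Γ) (E := insert B Γ) (fun ρ => ?_) ?_ ?_
      · have := GStep.disj Γ A B ρ
        rwa [Finset.insert_eq_of_mem hm] at this
      · refine (ihA _ (hV.ins hvv.1)).1 (by simp) fun Δ hs hVΔ he => ?_
        refine hk Δ (fun x hx => hs (by simp [hx])) hVΔ fun v hv => ?_
        have := he v hv
        simp_all [Fml.eval]
      · refine (ihB _ (hV.ins hvv.2)).1 (by simp) fun Δ hs hVΔ he => ?_
        refine hk Δ (fun x hx => hs (by simp [hx])) hVΔ fun v hv => ?_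
        have := he v hv
        simp_all [Fml.eval]
    · intro hm hk
      have hvv := hV _ hm
      simp only [Fml.vars, Finset.union_subset_iff] at hvv
      refine agood_one (Δ := insert A.neg (insert B.neg Γ)) (fun ρ => ?_) ?_
      · have := GStep.negdisj Γ A B ρ
        rwa [Finset.insert_eq_of_mem hm] at this
      refine (ihA _ ((hV.ins (A := B.neg) hvv.2).ins (A := A.neg) hvv.1)).2 (by simp) fun Δ hs hVΔ he => ?_
      refine (ihB Δ hVΔ).2 (hs (by simp)) fun Δ' hs' hVΔ' he' => ?_
      refine hk Δ' (fun x hx => hs' (hs (by simp [hx]))) hVΔ' fun v hv => ?_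
      have h1 := he.mono hs' v hv
      have h2 := he' v hv
      simp_all [Fml.eval]

theorem agood_decomp_all (V : Finset ℕ) (β : Datum) (S : Finset Fml) : ∀ Γ : Finset Fml,
    VarsIn V Γ → S ⊆ Γ →
    (∀ Δ, Γ ⊆ Δ → VarsIn V Δ → (∀ A ∈ S, Ent Δ A) → AGood V β Δ) → AGood V β Γ := by
  induction S using Finset.induction_on with
  | empty => intro Γ hV _ hk; exact hk Γ subset_rfl hV (by simp)
  | insert A S _ ih =>
    intro Γ hV hS hk
    refine (agood_decomp V β A Γ hV).1 (hS (by simp)) fun Δ hs hVΔ he => ?_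
    refine ih Δ hVΔ (fun x hx => hs (hS (by simp [hx]))) fun E hE hVE hT => ?_
    refine hk E (hs.trans hE) hVE fun B hB => ?_
    rcases Finset.mem_insert.1 hB with rfl | hB
    · exact he.mono hE
    · exact hT B hB

theorem agood_lits (V : Finset ℕ) (β : Datum) (Δ : Finset Fml) (hV : VarsIn V Δ)
    (hb : ∀ v, LitSat v Δ → Verifies v β) : AGood V β Δ := by
  by_cases hc : ∃ n, Fml.var n ∈ Δ ∧ (Fml.var n).neg ∈ Δ
  · obtain ⟨n, h1, h2⟩ := hc
    refine ⟨∅, by simp, fun ρ => Relation.ReflTransGen.single (Or.inr (Or.inl ⟨Δ, Fml.var n, ?_⟩))⟩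
    rw [Finset.insert_eq_of_mem h2, Finset.insert_eq_of_mem h1, Finset.union_empty]
  · classical
    set Λ : Finset Fml := Δ.filter
      (fun A => ∃ n ∈ DatumVars β, A = Fml.var n ∨ A = (Fml.var n).neg) with hΛ
    have hsub : Λ ⊆ Δ := Finset.filter_subset _ _
    refine ⟨{Λ}, ?_, fun ρ => Relation.ReflTransGen.single (Or.inr (Or.inr ⟨Λ, Δ, ρ, ?_, ?_⟩))⟩
    · intro Λ' h'
      rw [Finset.mem_singleton] at h'
      subst h'
      constructor
      · intro A hA
        refine Finset.subset_inter (hV A (hsub hA)) ?_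
        obtain ⟨-, n, hn, rfl | rfl⟩ := Finset.mem_filter.1 hA <;> simpa [Fml.vars] using hn
      · have hsat : LitSat (fun n => decide (Fml.var n ∈ Δ)) Δ := fun n =>
          ⟨fun h => by simpa using h, fun h => by
            simp only [decide_eq_false_iff_not]; exact fun h' => hc ⟨n, h', h⟩⟩
        refine pgood_complete β (DatumVars β) Λ (fun n hn => Or.inl hn) ⟨_, hsat.mono hsub⟩ ?_
        intro w hw
        refine verifies_congr (fun n => if n ∈ DatumVars β then w n else decide (Fml.var n ∈ Δ))
          w β (fun n hn => by simp [hn]) (hb _ fun n => ?_)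
        by_cases hn : n ∈ DatumVars β
        · simp only [hn, if_true]
          exact ⟨fun h => (hw n).1 (Finset.mem_filter.2 ⟨h, n, hn, Or.inl rfl⟩),
            fun h => (hw n).2 (Finset.mem_filter.2 ⟨h, n, hn, Or.inr rfl⟩)⟩
        · simp only [hn, if_false]
          exact hsat n
    · rw [Finset.union_eq_right.2 hsub]
    · rw [Finset.union_comm]; rfl

theorem agood_all (V : Finset ℕ) (β : Datum) (S : Datum) (h : ∀ Γ ∈ S, AGood V β Γ) :
    ∃ γ : Datum, (∀ Λ ∈ γ, (∀ A ∈ Λ, A.vars ⊆ V ∩ DatumVars β) ∧ PGood β Λ) ∧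
      ∀ ρ, AStar (S ∪ ρ) (ρ ∪ γ) := by
  induction S using Finset.induction_on with
  | empty => exact ⟨∅, by simp, fun ρ => by simpa using Relation.ReflTransGen.refl⟩
  | insert Γ S _ ih =>
    obtain ⟨γ, h1, h2⟩ := ih fun Γ hΓ => h Γ (by simp [hΓ])
    obtain ⟨γ', h1', h2'⟩ := h Γ (by simp)
    refine ⟨γ' ∪ γ, fun Λ hΛ => (Finset.mem_union.1 hΛ).elim (h1' Λ) (h1 Λ), fun ρ => ?_⟩
    rw [Finset.insert_union]
    refine (h2' _).trans ?_
    rw [Finset.union_assoc, ← Finset.union_assoc ρ]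
    exact h2 _

/-- Directional Interpolation for DC: if α ⊨ β then there is a datum γ whose
variables occur both in α and in β, such that γ is deducible from α by a
purely analytic DC-deduction and β is deducible from γ by a quasi-synthetic
DC-deduction (synthetic rules and S-rules only). -/
theorem dc_directional_interpolation (α β : Datum)
    (h : ∀ v : ℕ → Bool, Verifies v α → Verifies v β) :
    ∃ γ : Datum,
      DatumVars γ ⊆ DatumVars α ∩ DatumVars β ∧
      Relation.ReflTransGen
        (fun x y => GStep x y ∨ NCStep x y ∨ DelStep x y) α γ ∧
      Relation.ReflTransGen
        (fun x y => GStep y x ∨ EMStep x y ∨ DelStep x y ∨ ExpStep x y) γ β := by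
  have hall : ∀ Γ ∈ α, AGood (DatumVars α) β Γ := by
    intro Γ hΓ
    refine agood_decomp_all _ β Γ Γ (fun A hA => vars_sub hΓ hA) subset_rfl
      fun Δ _ hV he => agood_lits _ β Δ hV fun v hv => h v ⟨Γ, hΓ, fun A hA => he A hA v hv⟩
  obtain ⟨γ, h1, h2⟩ := agood_all _ β α hall
  refine ⟨γ, ?_, ?_, ?_⟩
  · exact Finset.sup_le fun Γ hΓ => Finset.sup_le fun A hA => (h1 Γ hΓ).1 A hA
  · have := h2 ∅
    rwa [Finset.union_empty, Finset.empty_union] at this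
  · have := pgood_all γ (fun Γ hΓ => (h1 Γ hΓ).2) ∅
    rwa [Finset.union_empty, Finset.empty_union] at this
end

section
/- Duality between DC and DDC: for all data α, β, there is a DC-deduction of β from α if and only if there is a DDC-deduction of d(α) from d(β); and for all dual data δ, ε, there is a DDC-deduction of ε from δ if and only if there is a DC-deduction of d(δ) from d(ε). Here d(α) is the dual datum (resp. datum) obtained from the datum (resp. dual datum) α by dualizing every formula, i.e. interchanging ∧ and ∨ throughout each formula, while keeping the same family of components. -/
/-- The dual of a formula: interchange ∧ and ∨ throughout. -/
def Fml.dual : Fml → Fml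
  | .var n => .var n
  | .neg A => .neg A.dual
  | .conj A B => .disj A.dual B.dual
  | .disj A B => .conj A.dual B.dual

/-- The dual of a datum (or dual datum): dualize every formula, keeping the
same family of components. -/
def dualize (α : Finset (Finset Fml)) : Finset (Finset Fml) :=
  α.image (Finset.image Fml.dual)

/-- One step of the Data Calculus DC. -/
def DCStep (α β : Datum) : Prop :=
  GStep α β ∨ GStep β α ∨ NCStep α β ∨ EMStep α β ∨ DelStep α β ∨ ExpStep α β

/-- One step of the Dual Data Calculus DDC. -/
def DDCStep (δ ε : DualDatum) : Prop :=
  DualGStep δ ε ∨ DualGStep ε δ ∨ DualEMStep δ ε ∨ DualNCStep δ ε ∨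
    DualExpStep δ ε ∨ DualDelStep δ ε

theorem Fml.dual_dual (A : Fml) : A.dual.dual = A := by
  induction A <;> simp_all [Fml.dual]

theorem dualize_dualize (α : Finset (Finset Fml)) : dualize (dualize α) = α := by
  have h : Fml.dual ∘ Fml.dual = id := funext Fml.dual_dual
  have h2 : (Finset.image Fml.dual ∘ Finset.image Fml.dual) = id := by
    funext s
    simp [Finset.image_image, h]
  simp [dualize, Finset.image_image, h2]

theorem dualize_insert (Γ : Finset Fml) (ρ : Finset (Finset Fml)) :
    dualize (insert Γ ρ) = insert (Γ.image Fml.dual) (dualize ρ) := by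
  simp [dualize, Finset.image_insert]

theorem GStep.dualStep {α β : Datum} (h : GStep α β) :
    DualGStep (dualize α) (dualize β) := by
  cases h <;> simp only [dualize_insert, Finset.image_insert, Fml.dual] <;> constructor

theorem DualGStep.dualStep {α β : DualDatum} (h : DualGStep α β) :
    GStep (dualize α) (dualize β) := by
  cases h <;> simp only [dualize_insert, Finset.image_insert, Fml.dual] <;> constructor

theorem DCStep.dualStep {α β : Datum} (h : DCStep α β) :
    DDCStep (dualize β) (dualize α) := by
  rcases h with h | h | ⟨Γ, A, rfl⟩ | ⟨Γ, A, ρ, rfl, rfl⟩ | ⟨Γ, Δ, ρ, rfl, rfl⟩ | ⟨Γ, rfl⟩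
  · exact Or.inr (Or.inl h.dualStep)
  · exact Or.inl h.dualStep
  · refine Or.inr (Or.inr (Or.inl ⟨Γ.image Fml.dual, A.dual, ?_⟩))
    simp only [dualize_insert, Finset.image_insert, Fml.dual]
  · refine Or.inr (Or.inr (Or.inr (Or.inl ⟨Γ.image Fml.dual, A.dual, dualize ρ, ?_, ?_⟩))) <;>
    simp only [dualize_insert, Finset.image_insert, Fml.dual]
  · refine Or.inr (Or.inr (Or.inr (Or.inr (Or.inl
      ⟨Γ.image Fml.dual, Δ.image Fml.dual, dualize ρ, ?_, ?_⟩)))) <;>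
    simp only [dualize_insert, Finset.image_union]
  · exact Or.inr (Or.inr (Or.inr (Or.inr (Or.inr ⟨Γ.image Fml.dual, dualize_insert _ _⟩))))

theorem DDCStep.dualStep {α β : DualDatum} (h : DDCStep α β) :
    DCStep (dualize β) (dualize α) := by
  rcases h with h | h | ⟨Γ, A, rfl⟩ | ⟨Γ, A, ρ, rfl, rfl⟩ | ⟨Γ, Δ, ρ, rfl, rfl⟩ | ⟨Γ, rfl⟩
  · exact Or.inr (Or.inl h.dualStep)
  · exact Or.inl h.dualStep
  · refine Or.inr (Or.inr (Or.inl ⟨Γ.image Fml.dual, A.dual, ?_⟩))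
    simp only [dualize_insert, Finset.image_insert, Fml.dual]
  · refine Or.inr (Or.inr (Or.inr (Or.inl ⟨Γ.image Fml.dual, A.dual, dualize ρ, ?_, ?_⟩))) <;>
    simp only [dualize_insert, Finset.image_insert, Fml.dual]
  · refine Or.inr (Or.inr (Or.inr (Or.inr (Or.inl
      ⟨Γ.image Fml.dual, Δ.image Fml.dual, dualize ρ, ?_, ?_⟩)))) <;>
    simp only [dualize_insert, Finset.image_union]
  · exact Or.inr (Or.inr (Or.inr (Or.inr (Or.inr ⟨Γ.image Fml.dual, dualize_insert _ _⟩))))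

theorem dc_to_ddc {α β : Datum} (h : Relation.ReflTransGen DCStep α β) :
    Relation.ReflTransGen DDCStep (dualize β) (dualize α) := by
  induction h with
  | refl => exact .refl
  | tail _ h ih => exact .head h.dualStep ih

theorem ddc_to_dc {α β : DualDatum} (h : Relation.ReflTransGen DDCStep α β) :
    Relation.ReflTransGen DCStep (dualize β) (dualize α) := by
  induction h with
  | refl => exact .refl
  | tail _ h ih => exact .head h.dualStep ih

/-- Duality between DC and DDC: β is DC-deducible from α iff d(α) is
DDC-deducible from d(β); and ε is DDC-deducible from δ iff d(δ) is
DC-deducible from d(ε). -/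
theorem dc_ddc_duality :
    (∀ α β : Datum,
      Relation.ReflTransGen DCStep α β ↔
        Relation.ReflTransGen DDCStep (dualize β) (dualize α)) ∧
    (∀ δ ε : DualDatum,
      Relation.ReflTransGen DDCStep δ ε ↔
        Relation.ReflTransGen DCStep (dualize ε) (dualize δ)) := by
  refine ⟨fun α β => ⟨dc_to_ddc, fun h => ?_⟩, fun δ ε => ⟨ddc_to_dc, fun h => ?_⟩⟩
  · simpa only [dualize_dualize] using ddc_to_dc h
  · simpa only [dualize_dualize] using dc_to_ddc h
end

section
/- Modularity Lemmas for DC: (Inner Modularity) for all finite sets of formulas Γ, Δ, Σ, if {Δ} is DC-deducible from {Γ}, then {Δ∪Σ} is DC-deducible from {Γ∪Σ}; (Outer Modularity) for all data α, β, ρ, if β is DC-deducible from α, then β∪ρ is DC-deducible from α∪ρ (where ∪ here is union of the sets of components). -/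
theorem gstep_union {α β : Datum} (ρ : Datum) (h : GStep α β) : GStep (α ∪ ρ) (β ∪ ρ) := by
  cases h <;> simp only [Finset.insert_union] <;> constructor

theorem gstep_image {α β : Datum} (Θ : Finset Fml) (h : GStep α β) :
    GStep (α.image (· ∪ Θ)) (β.image (· ∪ Θ)) := by
  cases h <;> simp only [Finset.image_insert, Finset.insert_union] <;> constructor

theorem dcstep_union {α β : Datum} (ρ : Datum) (h : DCStep α β) : DCStep (α ∪ ρ) (β ∪ ρ) := by
  rcases h with h | h | ⟨Γ, A, rfl⟩ | ⟨Γ, A, σ, rfl, rfl⟩ | ⟨Γ, Δ, σ, rfl, rfl⟩ | ⟨Γ, rfl⟩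
  · exact Or.inl (gstep_union ρ h)
  · exact Or.inr (Or.inl (gstep_union ρ h))
  · exact Or.inr (Or.inr (Or.inl ⟨Γ, A, by simp only [Finset.insert_union]⟩))
  · exact Or.inr (Or.inr (Or.inr (Or.inl ⟨Γ, A, σ ∪ ρ, by simp only [Finset.insert_union],
      by simp only [Finset.insert_union]⟩)))
  · exact Or.inr (Or.inr (Or.inr (Or.inr (Or.inl ⟨Γ, Δ, σ ∪ ρ,
      by simp only [Finset.insert_union], by simp only [Finset.insert_union]⟩))))
  · exact Or.inr (Or.inr (Or.inr (Or.inr (Or.inr ⟨Γ, by simp only [Finset.insert_union]⟩))))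

theorem dcstep_image {α β : Datum} (Θ : Finset Fml) (h : DCStep α β) :
    DCStep (α.image (· ∪ Θ)) (β.image (· ∪ Θ)) := by
  rcases h with h | h | ⟨Γ, A, rfl⟩ | ⟨Γ, A, σ, rfl, rfl⟩ | ⟨Γ, Δ, σ, rfl, rfl⟩ | ⟨Γ, rfl⟩
  · exact Or.inl (gstep_image Θ h)
  · exact Or.inr (Or.inl (gstep_image Θ h))
  · exact Or.inr (Or.inr (Or.inl ⟨Γ ∪ Θ, A, by
      simp only [Finset.image_insert, Finset.insert_union]⟩))
  · exact Or.inr (Or.inr (Or.inr (Or.inl ⟨Γ ∪ Θ, A, σ.image (· ∪ Θ), by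
      simp only [Finset.image_insert], by
      simp only [Finset.image_insert, Finset.insert_union]⟩)))
  · exact Or.inr (Or.inr (Or.inr (Or.inr (Or.inl ⟨Γ ∪ Θ, Δ, σ.image (· ∪ Θ), by
      simp only [Finset.image_insert, Finset.union_right_comm Γ Δ Θ], by
      simp only [Finset.image_insert]⟩))))
  · exact Or.inr (Or.inr (Or.inr (Or.inr (Or.inr ⟨Γ ∪ Θ, by
      simp only [Finset.image_insert]⟩))))

/-- Modularity Lemmas for DC. Inner Modularity: if {Δ} is DC-deducible from
{Γ} then {Δ∪Θ} is DC-deducible from {Γ∪Θ}. Outer Modularity: if β is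
DC-deducible from α then β∪ρ is DC-deducible from α∪ρ. -/
theorem dc_modularity :
    (∀ Γ Δ Θ : Finset Fml,
      Relation.ReflTransGen DCStep ({Γ} : Datum) ({Δ} : Datum) →
      Relation.ReflTransGen DCStep ({Γ ∪ Θ} : Datum) ({Δ ∪ Θ} : Datum)) ∧
    (∀ α β ρ : Datum,
      Relation.ReflTransGen DCStep α β →
      Relation.ReflTransGen DCStep (α ∪ ρ) (β ∪ ρ)) := by
  constructor
  · intro Γ Δ Θ h
    have := h.lift (fun α : Datum => α.image (· ∪ Θ)) (fun _ _ => dcstep_image Θ)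
    simpa only [Function.onFun, Finset.image_singleton] using this
  · intro α β ρ h
    exact h.lift (fun α : Datum => α ∪ ρ) (fun _ _ => dcstep_union ρ)
end

section
/- Soundness and completeness of the Equivalential Data Calculus EqDC: for all data α and β, there is an EqDC-deduction of β from α if and only if α and β are classically equivalent, i.e. verified by exactly the same interpretations. -/
/-- One step of the Equivalential Data Calculus EqDC: the G-rules in both
directions, NC in both directions (its inverse adds a component containing a
pair A, ¬A, possibly with further formulas), and EM in both directions. -/
def EqDCStep (α β : Datum) : Prop :=
  GStep α β ∨ GStep β α ∨ NCStep α β ∨ NCStep β α ∨ EMStep α β ∨ EMStep β α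

abbrev Deq (α β : Datum) : Prop := Relation.ReflTransGen EqDCStep α β

theorem EqDCStep.symm' {α β : Datum} (h : EqDCStep α β) : EqDCStep β α := by
  unfold EqDCStep at *; tauto

theorem Deq.symm {α β : Datum} (h : Deq α β) : Deq β α := by
  induction h with
  | refl => exact .refl
  | tail _ h ih => exact .trans (.single h.symm') ih

theorem Deq.trans {α β γ : Datum} (h : Deq α β) (h' : Deq β γ) : Deq α γ :=
  Relation.ReflTransGen.trans h h'

theorem GStep.union {α β : Datum} (γ : Datum) (h : GStep α β) : GStep (α ∪ γ) (β ∪ γ) := by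
  cases h <;> simp only [Finset.insert_union] <;> constructor

theorem NCStep.union {α β : Datum} (γ : Datum) (h : NCStep α β) : NCStep (α ∪ γ) (β ∪ γ) := by
  obtain ⟨Γ, A, rfl⟩ := h
  exact ⟨Γ, A, by simp only [Finset.insert_union]⟩

theorem EMStep.union {α β : Datum} (γ : Datum) (h : EMStep α β) : EMStep (α ∪ γ) (β ∪ γ) := by
  obtain ⟨Γ, A, ρ, rfl, rfl⟩ := h
  exact ⟨Γ, A, ρ ∪ γ, by simp only [Finset.insert_union], by simp only [Finset.insert_union]⟩

theorem EqDCStep.union {α β : Datum} (γ : Datum) (h : EqDCStep α β) :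
    EqDCStep (α ∪ γ) (β ∪ γ) := by
  rcases h with h | h | h | h | h | h
  · exact .inl (h.union γ)
  · exact .inr (.inl (h.union γ))
  · exact .inr (.inr (.inl (h.union γ)))
  · exact .inr (.inr (.inr (.inl (h.union γ))))
  · exact .inr (.inr (.inr (.inr (.inl (h.union γ)))))
  · exact .inr (.inr (.inr (.inr (.inr (h.union γ)))))

theorem Deq.union_right {α β : Datum} (γ : Datum) (h : Deq α β) : Deq (α ∪ γ) (β ∪ γ) := by
  induction h with
  | refl => exact .refl
  | tail _ h ih => exact .tail ih (h.union γ)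

theorem Deq.union {α β γ δ : Datum} (h : Deq α β) (h' : Deq γ δ) : Deq (α ∪ γ) (β ∪ δ) := by
  refine (h.union_right γ).trans ?_
  rw [Finset.union_comm β γ, Finset.union_comm β δ]
  exact h'.union_right β

theorem deq_em (Γ : Finset Fml) (A : Fml) : Deq {Γ} ({insert A Γ} ∪ {insert (Fml.neg A) Γ}) :=
  .single (.inr (.inr (.inr (.inr (.inl ⟨Γ, A, ∅, rfl, rfl⟩)))))

theorem deq_nc (Γ : Finset Fml) (A : Fml) : Deq {insert A (insert (Fml.neg A) Γ)} ∅ :=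
  .single (.inr (.inr (.inl ⟨Γ, A, rfl⟩)))

theorem deq_conj (Γ : Finset Fml) (A B : Fml) :
    Deq {insert (Fml.conj A B) Γ} {insert A (insert B Γ)} :=
  .single (.inl (GStep.conj Γ A B ∅))

theorem deq_disj (Γ : Finset Fml) (A B : Fml) :
    Deq {insert (Fml.disj A B) Γ} ({insert A Γ} ∪ {insert B Γ}) :=
  .single (.inl (GStep.disj Γ A B ∅))

def Fml.bnd : Fml → ℕ
  | .var i => i + 1
  | .neg A => A.bnd
  | .conj A B => max A.bnd B.bnd
  | .disj A B => max A.bnd B.bnd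

def lit (v : ℕ → Bool) (i : ℕ) : Fml := if v i = true then .var i else .neg (.var i)

theorem deq_fml (v : ℕ → Bool) (n : ℕ) (D : Finset Fml) (hD : ∀ i < n, lit v i ∈ D)
    (A : Fml) (hA : A.bnd ≤ n) : ∀ Γ, D ⊆ Γ →
      (A.eval v = true → Deq {insert A Γ} {Γ}) ∧ (A.eval v = false → Deq {insert A Γ} ∅) := by
  induction A with
  | var i =>
    intro Γ hΓ
    have h := hΓ (hD i (by simpa [Fml.bnd] using hA))
    constructor
    · intro hv
      simp only [Fml.eval] at hv
      simp only [lit, hv, if_true] at h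
      rw [Finset.insert_eq_self.2 h]
    · intro hv
      simp only [Fml.eval] at hv
      simp only [lit, hv] at h
      have h' : Fml.neg (.var i) ∈ Γ := by simpa using h
      have := deq_nc Γ (.var i)
      rwa [Finset.insert_eq_self.2 h'] at this
  | neg B ih =>
    intro Γ hΓ
    have ih := ih hA
    constructor
    · intro hv
      have hB : B.eval v = false := by simpa [Fml.eval] using hv
      have h := (deq_em Γ B).trans (((ih Γ hΓ).2 hB).union .refl)
      rw [Finset.empty_union] at h
      exact h.symm
    · intro hv
      have hB : B.eval v = true := by simpa [Fml.eval] using hv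
      exact ((ih _ (hΓ.trans (Finset.subset_insert _ _))).1 hB).symm.trans (deq_nc Γ B)
  | conj A B ihA ihB =>
    intro Γ hΓ
    have ihA := ihA ((le_max_left _ _).trans hA)
    have ihB := ihB ((le_max_right _ _).trans hA)
    have hA' := ihA (insert B Γ) (hΓ.trans (Finset.subset_insert _ _))
    have hB' := ihB Γ hΓ
    constructor
    · intro hv
      have hv' : A.eval v = true ∧ B.eval v = true := by simpa [Fml.eval] using hv
      exact (deq_conj Γ A B).trans ((hA'.1 hv'.1).trans (hB'.1 hv'.2))
    · intro hv
      refine (deq_conj Γ A B).trans ?_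
      cases h : A.eval v
      · exact hA'.2 h
      · have : B.eval v = false := by simpa [Fml.eval, h] using hv
        exact (hA'.1 h).trans (hB'.2 this)
  | disj A B ihA ihB =>
    intro Γ hΓ
    have hA' := ihA ((le_max_left _ _).trans hA) Γ hΓ
    have hB' := ihB ((le_max_right _ _).trans hA) Γ hΓ
    have key := deq_disj Γ A B
    cases h : A.eval v <;> cases h' : B.eval v <;> simp only [Fml.eval, h, h'] <;> simp
    · simpa using key.trans ((hA'.2 h).union (hB'.2 h'))
    · simpa using key.trans ((hA'.2 h).union (hB'.1 h'))
    · simpa using key.trans ((hA'.1 h).union (hB'.2 h'))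
    · simpa using key.trans ((hA'.1 h).union (hB'.1 h'))

theorem deq_comp (v : ℕ → Bool) (n : ℕ) (D : Finset Fml) (hD : ∀ i < n, lit v i ∈ D)
    (Γ : Finset Fml) (hΓ : ∀ A ∈ Γ, A.bnd ≤ n) :
    ((∀ A ∈ Γ, A.eval v = true) → Deq {Γ ∪ D} {D}) ∧
    ((¬ ∀ A ∈ Γ, A.eval v = true) → Deq {Γ ∪ D} ∅) := by
  induction Γ using Finset.induction_on with
  | empty => simp; exact .refl
  | insert A Γ _ ih =>
    have ih := ih fun B hB => hΓ B (Finset.mem_insert_of_mem hB)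
    have hA := deq_fml v n D hD A (hΓ A (Finset.mem_insert_self _ _)) (Γ ∪ D)
      Finset.subset_union_right
    rw [Finset.insert_union, Finset.forall_mem_insert]
    constructor
    · rintro ⟨h1, h2⟩
      exact (hA.1 h1).trans (ih.1 h2)
    · intro h
      cases h1 : A.eval v
      · exact hA.2 h1
      · exact (hA.1 h1).trans (ih.2 fun h2 => h ⟨h1, h2⟩)

theorem deq_datum (v : ℕ → Bool) (n : ℕ) (D : Finset Fml) (hD : ∀ i < n, lit v i ∈ D)
    (α : Datum) (hα : ∀ Γ ∈ α, ∀ A ∈ Γ, A.bnd ≤ n) :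
    (Verifies v α → Deq (α.image (· ∪ D)) {D}) ∧
    (¬ Verifies v α → Deq (α.image (· ∪ D)) ∅) := by
  induction α using Finset.induction_on with
  | empty => simp [Verifies]; exact .refl
  | insert Γ α _ ih =>
    have ih := ih fun B hB => hα B (Finset.mem_insert_of_mem hB)
    have hA := deq_comp v n D hD Γ (hα Γ (Finset.mem_insert_self _ _))
    have hV : Verifies v (insert Γ α) ↔ (∀ A ∈ Γ, A.eval v = true) ∨ Verifies v α := by
      simp [Verifies]
    rw [hV, Finset.image_insert, Finset.insert_eq]
    by_cases h : ∀ A ∈ Γ, A.eval v = true <;> by_cases h' : Verifies v α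
    · exact ⟨fun _ => by simpa using (hA.1 h).union (ih.1 h'), fun k => absurd (.inl h) k⟩
    · exact ⟨fun _ => by simpa using (hA.1 h).union (ih.2 h'), fun k => absurd (.inl h) k⟩
    · exact ⟨fun _ => by simpa using (hA.2 h).union (ih.1 h'), fun k => absurd (.inr h') k⟩
    · exact ⟨fun k => absurd k (by tauto), fun _ => by simpa using (hA.2 h).union (ih.2 h')⟩

theorem deq_split (α : Datum) (D : Finset Fml) (A : Fml) :
    Deq (α.image (· ∪ D))
      (α.image (· ∪ insert A D) ∪ α.image (· ∪ insert (Fml.neg A) D)) := by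
  induction α using Finset.induction_on with
  | empty => exact .refl
  | insert Γ α _ ih =>
    have h := (deq_em (Γ ∪ D) A).union ih
    rw [Finset.union_union_union_comm] at h
    simpa only [Finset.image_insert, Finset.insert_eq _ (Finset.image _ _), Finset.union_insert]
      using h

theorem deq_main (α β : Datum) (n : ℕ) (hα : ∀ Γ ∈ α, ∀ A ∈ Γ, A.bnd ≤ n)
    (hβ : ∀ Γ ∈ β, ∀ A ∈ Γ, A.bnd ≤ n) (h : ∀ v, Verifies v α ↔ Verifies v β) (k : ℕ) :
    ∀ (v : ℕ → Bool) (D : Finset Fml), (∀ i < n, k ≤ i → lit v i ∈ D) →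
      Deq (α.image (· ∪ D)) (β.image (· ∪ D)) := by
  induction k with
  | zero =>
    intro v D hD
    have hD' : ∀ i < n, lit v i ∈ D := fun i hi => hD i hi (Nat.zero_le _)
    have h1 := deq_datum v n D hD' α hα
    have h2 := deq_datum v n D hD' β hβ
    by_cases hv : Verifies v α
    · exact (h1.1 hv).trans (h2.1 ((h v).1 hv)).symm
    · exact (h1.2 hv).trans (h2.2 fun k => hv ((h v).2 k)).symm
  | succ k ih =>
    intro v D hD
    refine (deq_split α D (.var k)).trans (Deq.trans (Deq.union ?_ ?_)
      (deq_split β D (.var k)).symm)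
    · apply ih (Function.update v k true)
      intro i hi hk
      rcases hk.eq_or_lt with rfl | hk
      · simp [lit]
      · have := hD i hi hk
        simp only [lit, Function.update_of_ne hk.ne'] at this ⊢
        exact Finset.mem_insert_of_mem this
    · apply ih (Function.update v k false)
      intro i hi hk
      rcases hk.eq_or_lt with rfl | hk
      · simp [lit]
      · have := hD i hi hk
        simp only [lit, Function.update_of_ne hk.ne'] at this ⊢
        exact Finset.mem_insert_of_mem this

theorem verifies_insert (v : ℕ → Bool) (Γ : Finset Fml) (α : Datum) :
    Verifies v (insert Γ α) ↔ (∀ A ∈ Γ, A.eval v = true) ∨ Verifies v α := by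
  simp [Verifies]

theorem GStep.sound {α β : Datum} (h : GStep α β) (v : ℕ → Bool) :
    Verifies v α ↔ Verifies v β := by
  cases h <;> simp only [verifies_insert, Finset.forall_mem_insert, Fml.eval, Bool.and_eq_true,
    Bool.or_eq_true, Bool.not_eq_true', Bool.not_not, Bool.and_eq_false_iff,
    Bool.or_eq_false_iff, Bool.not_eq_false'] <;> tauto

theorem NCStep.sound {α β : Datum} (h : NCStep α β) (v : ℕ → Bool) :
    Verifies v α ↔ Verifies v β := by
  obtain ⟨Γ, A, rfl⟩ := h
  simp only [verifies_insert, Finset.forall_mem_insert, Fml.eval]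
  cases A.eval v <;> simp

theorem EMStep.sound {α β : Datum} (h : EMStep α β) (v : ℕ → Bool) :
    Verifies v α ↔ Verifies v β := by
  obtain ⟨Γ, A, ρ, rfl, rfl⟩ := h
  simp only [verifies_insert, Finset.forall_mem_insert, Fml.eval]
  cases A.eval v <;> simp

theorem EqDCStep.sound {α β : Datum} (h : EqDCStep α β) (v : ℕ → Bool) :
    Verifies v α ↔ Verifies v β := by
  rcases h with h | h | h | h | h | h
  · exact h.sound v
  · exact (h.sound v).symm
  · exact h.sound v
  · exact (h.sound v).symm
  · exact h.sound v
  · exact (h.sound v).symm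

/-- Soundness and completeness of EqDC: β is EqDC-deducible from α iff α and
β are verified by exactly the same interpretations. -/
theorem eqdc_soundness_completeness (α β : Datum) :
    Relation.ReflTransGen EqDCStep α β ↔
      ∀ v : ℕ → Bool, Verifies v α ↔ Verifies v β := by
  constructor
  · intro h v
    induction h with
    | refl => rfl
    | tail _ h ih => exact ih.trans (h.sound v)
  · intro h
    let n := (α ∪ β).sup fun Γ => Γ.sup Fml.bnd
    have hn : ∀ Γ ∈ α ∪ β, ∀ A ∈ Γ, A.bnd ≤ n := fun Γ hΓ A hA =>
      (Finset.le_sup (f := Fml.bnd) hA).trans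
        (Finset.le_sup (f := fun Γ : Finset Fml => Γ.sup Fml.bnd) hΓ)
    have := deq_main α β n (fun Γ hΓ => hn Γ (Finset.mem_union_left _ hΓ))
      (fun Γ hΓ => hn Γ (Finset.mem_union_right _ hΓ)) h n (fun _ => true) ∅
      (fun i h1 h2 => absurd h1 (not_lt.2 h2))
    simpa using this
end

section
/- Herbrand's theorem, satisfiability form: let A be a quantifier-free, equality-free first-order formula with free variables among x₁,…,xₙ. Then the universal closure ∀x₁…∀xₙ A is satisfiable (true in some structure with nonempty domain) if and only if the set Γ of all Herbrand instances of A — the formulas obtained by substituting for x₁,…,xₙ arbitrary terms built from individual variables and the function symbols occurring in A — is propositionally satisfiable, i.e. there is an assignment of truth-values to atomic formulas under which every member of Γ evaluates to true truth-functionally. -/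
/-- First-order terms over a family `Fn` of function symbols (with `Fn n` the
`n`-ary symbols; 0-ary symbols are constants), with individual variables
indexed by ℕ. -/
inductive Term (Fn : ℕ → Type) : Type
  | var : ℕ → Term Fn
  | app : {n : ℕ} → Fn n → (Fin n → Term Fn) → Term Fn

/-- Quantifier-free, equality-free first-order formulas over function symbols
`Fn` and relation symbols `Rl`. -/
inductive QFForm (Fn Rl : ℕ → Type) : Type
  | atom : {n : ℕ} → Rl n → (Fin n → Term Fn) → QFForm Fn Rl
  | neg : QFForm Fn Rl → QFForm Fn Rl
  | conj : QFForm Fn Rl → QFForm Fn Rl → QFForm Fn Rl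
  | disj : QFForm Fn Rl → QFForm Fn Rl → QFForm Fn Rl

variable {Fn Rl : ℕ → Type}

/-- The variable `x` occurs in a term. -/
inductive Term.UsesVar : Term Fn → ℕ → Prop
  | var (x : ℕ) : Term.UsesVar (.var x) x
  | app {n : ℕ} (f : Fn n) (ts : Fin n → Term Fn) (i : Fin n) (x : ℕ) :
      Term.UsesVar (ts i) x → Term.UsesVar (.app f ts) x

/-- The variable `x` occurs (free) in a quantifier-free formula. -/
inductive QFForm.UsesVar : QFForm Fn Rl → ℕ → Prop
  | atom {n : ℕ} (R : Rl n) (ts : Fin n → Term Fn) (i : Fin n) (x : ℕ) :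
      Term.UsesVar (ts i) x → QFForm.UsesVar (.atom R ts) x
  | neg (A : QFForm Fn Rl) (x : ℕ) :
      QFForm.UsesVar A x → QFForm.UsesVar (.neg A) x
  | conjL (A B : QFForm Fn Rl) (x : ℕ) :
      QFForm.UsesVar A x → QFForm.UsesVar (.conj A B) x
  | conjR (A B : QFForm Fn Rl) (x : ℕ) :
      QFForm.UsesVar B x → QFForm.UsesVar (.conj A B) x
  | disjL (A B : QFForm Fn Rl) (x : ℕ) :
      QFForm.UsesVar A x → QFForm.UsesVar (.disj A B) x
  | disjR (A B : QFForm Fn Rl) (x : ℕ) :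
      QFForm.UsesVar B x → QFForm.UsesVar (.disj A B) x

/-- The function symbol `f` occurs in a term. -/
inductive Term.UsesFn : Term Fn → ∀ n : ℕ, Fn n → Prop
  | here {n : ℕ} (f : Fn n) (ts : Fin n → Term Fn) :
      Term.UsesFn (.app f ts) n f
  | there {n : ℕ} (f : Fn n) (ts : Fin n → Term Fn) (i : Fin n)
      {m : ℕ} (g : Fn m) :
      Term.UsesFn (ts i) m g → Term.UsesFn (.app f ts) m g

/-- The function symbol `f` occurs in a quantifier-free formula. -/
inductive QFForm.UsesFn : QFForm Fn Rl → ∀ n : ℕ, Fn n → Prop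
  | atom {n : ℕ} (R : Rl n) (ts : Fin n → Term Fn) (i : Fin n)
      {m : ℕ} (g : Fn m) :
      Term.UsesFn (ts i) m g → QFForm.UsesFn (.atom R ts) m g
  | neg (A : QFForm Fn Rl) {m : ℕ} (g : Fn m) :
      QFForm.UsesFn A m g → QFForm.UsesFn (.neg A) m g
  | conjL (A B : QFForm Fn Rl) {m : ℕ} (g : Fn m) :
      QFForm.UsesFn A m g → QFForm.UsesFn (.conj A B) m g
  | conjR (A B : QFForm Fn Rl) {m : ℕ} (g : Fn m) :
      QFForm.UsesFn B m g → QFForm.UsesFn (.conj A B) m g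
  | disjL (A B : QFForm Fn Rl) {m : ℕ} (g : Fn m) :
      QFForm.UsesFn A m g → QFForm.UsesFn (.disj A B) m g
  | disjR (A B : QFForm Fn Rl) {m : ℕ} (g : Fn m) :
      QFForm.UsesFn B m g → QFForm.UsesFn (.disj A B) m g

/-- A term is built from individual variables and function symbols
satisfying `P` only. -/
inductive Term.OnlyFns (P : ∀ n : ℕ, Fn n → Prop) : Term Fn → Prop
  | var (x : ℕ) : Term.OnlyFns P (.var x)
  | app {n : ℕ} (f : Fn n) (ts : Fin n → Term Fn) :
      P n f → (∀ i, Term.OnlyFns P (ts i)) → Term.OnlyFns P (.app f ts)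

/-- Uniform substitution of terms for variables, in a term. -/
def Term.subst (θ : ℕ → Term Fn) : Term Fn → Term Fn
  | .var x => θ x
  | .app f ts => .app f fun i => (ts i).subst θ

/-- Uniform substitution of terms for (the free occurrences of) variables,
in a quantifier-free formula. -/
def QFForm.subst (θ : ℕ → Term Fn) : QFForm Fn Rl → QFForm Fn Rl
  | .atom R ts => .atom R fun i => (ts i).subst θ
  | .neg A => .neg (A.subst θ)
  | .conj A B => .conj (A.subst θ) (B.subst θ)
  | .disj A B => .disj (A.subst θ) (B.subst θ)

/-- Evaluation of a term in a structure with domain `D`, function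
interpretation `fI` and variable assignment `v`. -/
def Term.eval {D : Type} (fI : ∀ n : ℕ, Fn n → (Fin n → D) → D)
    (v : ℕ → D) : Term Fn → D
  | .var x => v x
  | .app f ts => fI _ f fun i => (ts i).eval fI v

/-- Truth of a quantifier-free formula in a structure (domain `D`, function
interpretation `fI`, relation interpretation `rI`) under an assignment `v`. -/
def QFForm.eval {D : Type} (fI : ∀ n : ℕ, Fn n → (Fin n → D) → D)
    (rI : ∀ n : ℕ, Rl n → (Fin n → D) → Prop) (v : ℕ → D) :
    QFForm Fn Rl → Prop
  | .atom R ts => rI _ R fun i => (ts i).eval fI v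
  | .neg A => ¬ A.eval fI rI v
  | .conj A B => A.eval fI rI v ∧ B.eval fI rI v
  | .disj A B => A.eval fI rI v ∨ B.eval fI rI v

/-- Truth-functional evaluation of a quantifier-free formula under a
propositional interpretation `π`, which assigns a truth-value to every
atomic formula. -/
def QFForm.evalProp (π : ∀ n : ℕ, Rl n → (Fin n → Term Fn) → Prop) :
    QFForm Fn Rl → Prop
  | .atom R ts => π _ R ts
  | .neg A => ¬ A.evalProp π
  | .conj A B => A.evalProp π ∧ B.evalProp π
  | .disj A B => A.evalProp π ∨ B.evalProp π

/-- `θ` is a Herbrand substitution for the variables below `n`, with respect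
to the function symbols satisfying `P`: it substitutes, for each variable
below `n`, a term built from individual variables and function symbols
satisfying `P`, and leaves all other variables unchanged. -/
def HerbrandSubst (P : ∀ n : ℕ, Fn n → Prop) (n : ℕ) (θ : ℕ → Term Fn) : Prop :=
  (∀ x, x < n → (θ x).OnlyFns P) ∧ ∀ x, n ≤ x → θ x = .var x

theorem Term.eval_subst {D : Type} (fI : ∀ n : ℕ, Fn n → (Fin n → D) → D) (v : ℕ → D)
    (θ : ℕ → Term Fn) (t : Term Fn) :
    (t.subst θ).eval fI v = t.eval fI (fun x => (θ x).eval fI v) := by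
  induction t with
  | var x => rfl
  | app f ts ih => simp only [Term.subst, Term.eval, ih]

theorem QFForm.evalProp_subst_eval {D : Type} (fI : ∀ n : ℕ, Fn n → (Fin n → D) → D)
    (rI : ∀ n : ℕ, Rl n → (Fin n → D) → Prop) (v : ℕ → D)
    (θ : ℕ → Term Fn) (A : QFForm Fn Rl) :
    (A.subst θ).evalProp (fun _ R ts => rI _ R fun i => (ts i).eval fI v) ↔
      A.eval fI rI (fun x => (θ x).eval fI v) := by
  induction A with
  | atom R ts => simp only [QFForm.subst, QFForm.evalProp, QFForm.eval, Term.eval_subst]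
  | neg A ih => simp only [QFForm.subst, QFForm.evalProp, QFForm.eval, ih]
  | conj A B ih1 ih2 => simp only [QFForm.subst, QFForm.evalProp, QFForm.eval, ih1, ih2]
  | disj A B ih1 ih2 => simp only [QFForm.subst, QFForm.evalProp, QFForm.eval, ih1, ih2]

open Classical in
/-- Function interpretation on the Herbrand universe. -/
noncomputable def herbrandFI (P : ∀ n : ℕ, Fn n → Prop) (m : ℕ) (f : Fn m)
    (ts : Fin m → {t : Term Fn // t.OnlyFns P}) : {t : Term Fn // t.OnlyFns P} :=
  if h : P m f then ⟨.app f fun i => (ts i).1, .app f _ h fun i => (ts i).2⟩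
  else ⟨.var 0, .var 0⟩

theorem Term.eval_herbrand (P : ∀ n : ℕ, Fn n → Prop) (n : ℕ)
    (v : ℕ → {t : Term Fn // t.OnlyFns P}) (θ : ℕ → Term Fn)
    (hθ : ∀ x, x < n → θ x = (v x).1) (t : Term Fn)
    (hv : ∀ x, t.UsesVar x → x < n) (hf : ∀ m f, t.UsesFn m f → P m f) :
    (t.eval (herbrandFI P) v).1 = t.subst θ := by
  induction t with
  | var x => exact (hθ x (hv x (.var x))).symm
  | app f ts ih =>
    have h := hf _ f (.here f ts)
    simp only [Term.eval, Term.subst, herbrandFI, dif_pos h]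
    congr 1
    funext i
    exact ih i (fun x hx => hv x (.app f ts i x hx)) (fun m g hg => hf m g (.there f ts i g hg))

theorem QFForm.eval_herbrand (P : ∀ n : ℕ, Fn n → Prop) (n : ℕ)
    (v : ℕ → {t : Term Fn // t.OnlyFns P}) (θ : ℕ → Term Fn)
    (π : ∀ m : ℕ, Rl m → (Fin m → Term Fn) → Prop)
    (hθ : ∀ x, x < n → θ x = (v x).1) (A : QFForm Fn Rl)
    (hv : ∀ x, A.UsesVar x → x < n) (hf : ∀ m f, A.UsesFn m f → P m f) :
    A.eval (herbrandFI P) (fun m R ts => π m R fun i => (ts i).1) v ↔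
      (A.subst θ).evalProp π := by
  induction A with
  | atom R ts =>
    have h : (fun i => ((ts i).eval (herbrandFI P) v).1) = fun i => (ts i).subst θ := by
      funext i
      exact Term.eval_herbrand P n v θ hθ (ts i) (fun x hx => hv x (.atom R ts i x hx))
        (fun m g hg => hf m g (.atom R ts i g hg))
    simp only [QFForm.subst, QFForm.evalProp, QFForm.eval, h]
  | neg A ih =>
    exact not_congr (ih (fun x hx => hv x (.neg A x hx)) (fun m g hg => hf m g (.neg A g hg)))
  | conj A B ih1 ih2 =>
    exact and_congr
      (ih1 (fun x hx => hv x (.conjL A B x hx)) (fun m g hg => hf m g (.conjL A B g hg)))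
      (ih2 (fun x hx => hv x (.conjR A B x hx)) (fun m g hg => hf m g (.conjR A B g hg)))
  | disj A B ih1 ih2 =>
    exact or_congr
      (ih1 (fun x hx => hv x (.disjL A B x hx)) (fun m g hg => hf m g (.disjL A B g hg)))
      (ih2 (fun x hx => hv x (.disjR A B x hx)) (fun m g hg => hf m g (.disjR A B g hg)))

/-- Herbrand's theorem, satisfiability form: for quantifier-free,
equality-free `A` with free variables among the first `n` variables, the
universal closure of `A` is satisfiable in some structure with nonempty
domain iff the set of all Herbrand instances of `A` (with respect to the
function symbols occurring in `A`) is propositionally satisfiable. -/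
theorem herbrand_satisfiability (Fn Rl : ℕ → Type) (A : QFForm Fn Rl)
    (n : ℕ) (hfree : ∀ x, A.UsesVar x → x < n) :
    (∃ (D : Type), Nonempty D ∧
      ∃ (fI : ∀ m : ℕ, Fn m → (Fin m → D) → D)
        (rI : ∀ m : ℕ, Rl m → (Fin m → D) → Prop),
        ∀ v : ℕ → D, A.eval fI rI v) ↔
    (∃ π : ∀ m : ℕ, Rl m → (Fin m → Term Fn) → Prop,
      ∀ θ : ℕ → Term Fn, HerbrandSubst (fun m f => A.UsesFn m f) n θ →
        (A.subst θ).evalProp π) := by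
  constructor
  · rintro ⟨D, ⟨d⟩, fI, rI, h⟩
    refine ⟨fun _ R ts => rI _ R fun i => (ts i).eval fI fun _ => d, fun θ _ => ?_⟩
    exact (QFForm.evalProp_subst_eval fI rI (fun _ => d) θ A).2 (h _)
  · rintro ⟨π, h⟩
    refine ⟨{t : Term Fn // t.OnlyFns (fun m f => A.UsesFn m f)}, ⟨⟨.var 0, .var 0⟩⟩,
      herbrandFI _, fun m R ts => π m R fun i => (ts i).1, fun v => ?_⟩
    refine (QFForm.eval_herbrand _ n v (fun x => if x < n then (v x).1 else .var x) π
      (fun x hx => if_pos hx) A hfree (fun _ _ hf => hf)).2 (h _ ⟨fun x hx => ?_, fun x hx => ?_⟩)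
    · simp only [if_pos hx]
      exact (v x).2
    · exact if_neg (not_lt.2 hx)
end

section
/- Compactness theorem for FDE consequence: for all (possibly infinite) sets of formulas Γ and Δ, if Γ ⊨_FDE Δ then there exist finite subsets Γ₀ ⊆ Γ and Δ₀ ⊆ Δ such that Γ₀ ⊨_FDE Δ₀. -/
/-- The exact (basic) truthmaker semantics: the bilateral proposition
(truthmaker set, falsity-maker set) assigned to a formula, given an
assignment `σ` of bilateral propositions over a set `S` of elementary
situations to the propositional variables. States are subsets of `S`. -/
def Sem {S : Type} (σ : ℕ → Set (Set S) × Set (Set S)) :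
    Fml → Set (Set S) × Set (Set S)
  | .var p => σ p
  | .neg A => ((Sem σ A).2, (Sem σ A).1)
  | .conj A B =>
      ({s | ∃ s₁ ∈ (Sem σ A).1, ∃ s₂ ∈ (Sem σ B).1, s = s₁ ∪ s₂},
       (Sem σ A).2 ∪ (Sem σ B).2)
  | .disj A B =>
      ((Sem σ A).1 ∪ (Sem σ B).1,
       {s | ∃ s₁ ∈ (Sem σ A).2, ∃ s₂ ∈ (Sem σ B).2, s = s₁ ∪ s₂})

/-- `σ` is a model-assignment: each variable gets a bilateral proposition,
i.e. a pair of sets of states with distinct components. -/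
def IsModel {S : Type} (σ : ℕ → Set (Set S) × Set (Set S)) : Prop :=
  ∀ p : ℕ, (σ p).1 ≠ (σ p).2

/-- The truthmakers of a (possibly infinite) set of formulas read
conjunctively: unions of one chosen truthmaker per member. -/
def ConjTM {S : Type} (σ : ℕ → Set (Set S) × Set (Set S)) (Γ : Set Fml) :
    Set (Set S) :=
  {s | ∃ f : Fml → Set S, (∀ A ∈ Γ, f A ∈ (Sem σ A).1) ∧ s = ⋃ A ∈ Γ, f A}

/-- The truthmakers of a set of formulas read disjunctively: the truthmakers
of its members. -/
def DisjTM {S : Type} (σ : ℕ → Set (Set S) × Set (Set S)) (Δ : Set Fml) :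
    Set (Set S) :=
  ⋃ B ∈ Δ, (Sem σ B).1

/-- FDE consequence between sets of formulas: in every model, every
truthmaker of Γ (read conjunctively) includes some truthmaker of Δ (read
disjunctively). -/
def FDECons (Γ Δ : Set Fml) : Prop :=
  ∀ (S : Type) (σ : ℕ → Set (Set S) × Set (Set S)), IsModel σ →
    ∀ s ∈ ConjTM σ Γ, ∃ s' ∈ DisjTM σ Δ, s' ⊆ s

def ev4 (v : ℕ × Bool → Bool) : Fml → Bool × Bool
  | .var p => (v (p, true), v (p, false))
  | .neg A => ((ev4 v A).2, (ev4 v A).1)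
  | .conj A B => ((ev4 v A).1 && (ev4 v B).1, (ev4 v A).2 || (ev4 v B).2)
  | .disj A B => ((ev4 v A).1 || (ev4 v B).1, (ev4 v A).2 && (ev4 v B).2)

theorem ev4_cont (A : Fml) : Continuous (fun v => ev4 v A) := by
  have key : ∀ g : Bool × Bool → Bool, Continuous g := fun g => continuous_of_discreteTopology
  induction A with
  | var p => exact (continuous_apply _).prodMk (continuous_apply _)
  | neg A ih => exact (continuous_snd.comp ih).prodMk (continuous_fst.comp ih)
  | conj A B iA iB =>
    exact ((key (fun x => x.1 && x.2)).comp
      ((continuous_fst.comp iA).prodMk (continuous_fst.comp iB))).prodMk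
      ((key (fun x => x.1 || x.2)).comp
      ((continuous_snd.comp iA).prodMk (continuous_snd.comp iB)))
  | disj A B iA iB =>
    exact ((key (fun x => x.1 || x.2)).comp
      ((continuous_fst.comp iA).prodMk (continuous_fst.comp iB))).prodMk
      ((key (fun x => x.1 && x.2)).comp
      ((continuous_snd.comp iA).prodMk (continuous_snd.comp iB)))

theorem exists_union_sub {S : Type} (X Y : Set (Set S)) (s : Set S) :
    (∃ t ∈ {u | ∃ s₁ ∈ X, ∃ s₂ ∈ Y, u = s₁ ∪ s₂}, t ⊆ s) ↔
      (∃ t ∈ X, t ⊆ s) ∧ (∃ t ∈ Y, t ⊆ s) := by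
  constructor
  · rintro ⟨_, ⟨a, ha, b, hb, rfl⟩, h⟩
    exact ⟨⟨a, ha, Set.subset_union_left.trans h⟩, ⟨b, hb, Set.subset_union_right.trans h⟩⟩
  · rintro ⟨⟨a, ha, h⟩, ⟨b, hb, h'⟩⟩
    exact ⟨_, ⟨a, ha, b, hb, rfl⟩, Set.union_subset h h'⟩

theorem exists_or_sub {S : Type} (X Y : Set (Set S)) (s : Set S) :
    (∃ t ∈ X ∪ Y, t ⊆ s) ↔ (∃ t ∈ X, t ⊆ s) ∨ (∃ t ∈ Y, t ⊆ s) := by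
  simp only [Set.mem_union, or_and_right, exists_or]

theorem ev4_sem {S : Type} (σ : ℕ → Set (Set S) × Set (Set S)) (s : Set S)
    (v : ℕ × Bool → Bool)
    (h1 : ∀ p, v (p, true) = true ↔ ∃ t ∈ (σ p).1, t ⊆ s)
    (h2 : ∀ p, v (p, false) = true ↔ ∃ t ∈ (σ p).2, t ⊆ s) (A : Fml) :
    ((ev4 v A).1 = true ↔ ∃ t ∈ (Sem σ A).1, t ⊆ s) ∧
    ((ev4 v A).2 = true ↔ ∃ t ∈ (Sem σ A).2, t ⊆ s) := by
  induction A with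
  | var p => exact ⟨h1 p, h2 p⟩
  | neg A ih => exact ⟨ih.2, ih.1⟩
  | conj A B iA iB =>
    simp only [ev4, Sem, exists_union_sub, exists_or_sub, Bool.and_eq_true, Bool.or_eq_true,
      iA.1, iA.2, iB.1, iB.2, and_self]
  | disj A B iA iB =>
    simp only [ev4, Sem, exists_union_sub, exists_or_sub, Bool.and_eq_true, Bool.or_eq_true,
      iA.1, iA.2, iB.1, iB.2, and_self]

theorem fde_iff_ev4 (Γ Δ : Set Fml) : FDECons Γ Δ ↔
    ∀ v, (∀ A ∈ Γ, (ev4 v A).1 = true) → ∃ B ∈ Δ, (ev4 v B).1 = true := by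
  constructor
  · intro h v hv
    let σ : ℕ → Set (Set (ℕ × Bool)) × Set (Set (ℕ × Bool)) :=
      fun p => ({{(p, true)}}, {{(p, false)}})
    have hm : IsModel σ := by
      intro p
      simp [σ]
    have hs := ev4_sem σ {x | v x = true} v (by simp [σ]) (by simp [σ])
    have hc : ∀ A, ∃ t, A ∈ Γ → t ∈ (Sem σ A).1 ∧ t ⊆ {x | v x = true} := by
      intro A
      by_cases hA : A ∈ Γ
      · obtain ⟨t, ht⟩ := (hs A).1.1 (hv A hA)
        exact ⟨t, fun _ => ht⟩
      · exact ⟨∅, fun h => absurd h hA⟩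
    choose f hf using hc
    obtain ⟨s', hs', hsub⟩ := h _ σ hm _ ⟨f, fun A hA => (hf A hA).1, rfl⟩
    simp only [DisjTM, Set.mem_iUnion] at hs'
    obtain ⟨B, hB, hB'⟩ := hs'
    exact ⟨B, hB, (hs B).1.2 ⟨s', hB', hsub.trans (Set.iUnion₂_subset fun A hA => (hf A hA).2)⟩⟩
  · rintro h S σ - s ⟨f, hf, rfl⟩
    classical
    let s := ⋃ A ∈ Γ, f A
    let v : ℕ × Bool → Bool := fun x =>
      decide (∃ t ∈ (if x.2 = true then (σ x.1).1 else (σ x.1).2), t ⊆ s)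
    have hs := ev4_sem σ s v (by simp [v]) (by simp [v])
    obtain ⟨B, hB, hB'⟩ := h v (fun A hA => (hs A).1.2
      ⟨f A, hf A hA, Set.subset_biUnion_of_mem (u := f) hA⟩)
    obtain ⟨t, ht, hts⟩ := (hs B).1.1 hB'
    refine ⟨t, ?_, hts⟩
    simp only [DisjTM, Set.mem_iUnion]
    exact ⟨B, hB, ht⟩

/-- Compactness theorem for FDE consequence: if Γ ⊨_FDE Δ then some finite
Γ₀ ⊆ Γ and Δ₀ ⊆ Δ satisfy Γ₀ ⊨_FDE Δ₀. -/
theorem fde_compactness (Γ Δ : Set Fml) (h : FDECons Γ Δ) :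
    ∃ (Γ₀ Δ₀ : Finset Fml), ↑Γ₀ ⊆ Γ ∧ ↑Δ₀ ⊆ Δ ∧
      FDECons (↑Γ₀ : Set Fml) (↑Δ₀ : Set Fml) := by
  rw [fde_iff_ev4] at h
  let U : Γ ⊕ Δ → Set (ℕ × Bool → Bool) := Sum.elim
    (fun A => {v | (ev4 v A.1).1 = false}) (fun B => {v | (ev4 v B.1).1 = true})
  have ho : ∀ (A : Fml) (b : Bool), IsOpen {v | (ev4 v A).1 = b} := fun A b =>
    (isOpen_discrete ({b} : Set Bool)).preimage (continuous_fst.comp (ev4_cont A))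
  obtain ⟨t, ht⟩ := isCompact_univ.elim_finite_subcover U
    (by rintro (A | B); exacts [ho _ _, ho _ _])
    (by
      intro v _
      rw [Set.mem_iUnion]
      by_cases hv : ∀ A ∈ Γ, (ev4 v A).1 = true
      · obtain ⟨B, hB, hB'⟩ := h v hv
        exact ⟨Sum.inr ⟨B, hB⟩, hB'⟩
      · push Not at hv
        obtain ⟨A, hA, hA'⟩ := hv
        exact ⟨Sum.inl ⟨A, hA⟩, by simpa [U] using hA'⟩)
  refine ⟨t.toLeft.image Subtype.val, t.toRight.image Subtype.val, ?_, ?_, ?_⟩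
  · intro A hA
    simp only [Finset.coe_image, Set.mem_image] at hA
    obtain ⟨a, -, rfl⟩ := hA
    exact a.2
  · intro A hA
    simp only [Finset.coe_image, Set.mem_image] at hA
    obtain ⟨a, -, rfl⟩ := hA
    exact a.2
  · rw [fde_iff_ev4]
    intro v hv
    have := ht (Set.mem_univ v)
    simp only [Set.mem_iUnion] at this
    obtain ⟨A | B, hi, hu⟩ := this
    · have h1 := hv A.1 (Finset.mem_coe.2 (Finset.mem_image.2 ⟨A, by simpa using hi, rfl⟩))
      have h2 : (ev4 v A.1).1 = false := hu
      rw [h1] at h2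
      cases h2
    · exact ⟨B.1, Finset.mem_coe.2 (Finset.mem_image.2 ⟨B, by simpa using hi, rfl⟩), hu⟩
end

section
/- Normal-deduction completeness of FDEDC: for all data α and β, if α ⊨_FDE β then there exists a normal FDEDC-deduction of β from α, i.e. one consisting of applications of analytic rules followed by applications of synthetic rules. -/
/-- The truthmakers of a datum: read a component as the conjunction of its
formulas (unions of one chosen truthmaker per formula) and the datum as the
disjunction of its components. -/
def DatumTM {S : Type} (σ : ℕ → Set (Set S) × Set (Set S)) (α : Datum) :
    Set (Set S) :=
  {s | ∃ Γ ∈ α, ∃ f : Fml → Set S,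
        (∀ A ∈ Γ, f A ∈ (Sem σ A).1) ∧ s = ⋃ A ∈ Γ, f A}

/-- FDE consequence between data: in every model, every truthmaker of α
includes some truthmaker of β. -/
def FDEConsD (α β : Datum) : Prop :=
  ∀ (S : Type) (σ : ℕ → Set (Set S) × Set (Set S)), IsModel σ →
    ∀ s ∈ DatumTM σ α, ∃ s' ∈ DatumTM σ β, s' ⊆ s

namespace FDEAux

def size : Fml → ℕ
  | .var _ => 1
  | .neg A => size A + 1
  | .conj A B => size A + size B + 2
  | .disj A B => size A + size B + 2

def Lit (A : Fml) : Prop := ∃ p, A = .var p ∨ A = .neg (.var p)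

def LitD (α : Datum) : Prop := ∀ Γ ∈ α, ∀ A ∈ Γ, Lit A

def m (Γ : Finset Fml) : ℕ := ∑ A ∈ Γ, size A

lemma m_insert_le (A : Fml) (Γ : Finset Fml) : m (insert A Γ) ≤ size A + m Γ := by
  unfold m
  by_cases h : A ∈ Γ
  · rw [Finset.insert_eq_of_mem h]; omega
  · rw [Finset.sum_insert h]

abbrev GS := Relation.ReflTransGen GStep

lemma union_insert' (L ρ : Datum) (Γ : Finset Fml) : L ∪ insert Γ ρ = insert Γ (L ∪ ρ) := by
  ext x; simp only [Finset.mem_union, Finset.mem_insert]; tauto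

lemma two {n : ℕ} (ih : ∀ Γ, m Γ < n → ∀ ρ : Datum, ∃ L, LitD L ∧ GS (insert Γ ρ) (L ∪ ρ))
    (Γ₁ Γ₂ : Finset Fml) (h₁ : m Γ₁ < n) (h₂ : m Γ₂ < n) (ρ : Datum) :
    ∃ L, LitD L ∧ GS (insert Γ₁ (insert Γ₂ ρ)) (L ∪ ρ) := by
  obtain ⟨L₁, hL₁, g₁⟩ := ih Γ₁ h₁ (insert Γ₂ ρ)
  obtain ⟨L₂, hL₂, g₂⟩ := ih Γ₂ h₂ (L₁ ∪ ρ)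
  refine ⟨L₂ ∪ L₁, ?_, ?_⟩
  · intro Γ hΓ
    rcases Finset.mem_union.1 hΓ with h | h
    · exact hL₂ Γ h
    · exact hL₁ Γ h
  · rw [union_insert'] at g₁
    rw [Finset.union_assoc]
    exact g₁.trans g₂

lemma comp_dnf (n : ℕ) : ∀ Γ, m Γ < n → ∀ ρ : Datum, ∃ L, LitD L ∧ GS (insert Γ ρ) (L ∪ ρ) := by
  induction n with
  | zero => intro Γ h; omega
  | succ n ih =>
    intro Γ hΓ ρ
    by_cases hl : ∀ A ∈ Γ, Lit A
    · refine ⟨{Γ}, ?_, ?_⟩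
      · intro Δ hΔ; rw [Finset.mem_singleton.1 hΔ]; exact hl
      · exact Relation.ReflTransGen.refl
    push Not at hl
    obtain ⟨C, hC, hn⟩ := hl
    have hs : m Γ = size C + m (Γ.erase C) := (Finset.add_sum_erase Γ size hC).symm
    rw [← Finset.insert_erase hC]
    generalize Γ.erase C = Θ at hs
    have one : ∀ Γ' : Finset Fml, m Γ' < n →
        GStep (insert (insert C Θ) ρ) (insert Γ' ρ) →
        ∃ L, LitD L ∧ GS (insert (insert C Θ) ρ) (L ∪ ρ) := by
      intro Γ' h st
      obtain ⟨L, hL, g⟩ := ih Γ' h ρ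
      exact ⟨L, hL, g.head st⟩
    have tw : ∀ Γ₁ Γ₂ : Finset Fml, m Γ₁ < n → m Γ₂ < n →
        GStep (insert (insert C Θ) ρ) (insert Γ₁ (insert Γ₂ ρ)) →
        ∃ L, LitD L ∧ GS (insert (insert C Θ) ρ) (L ∪ ρ) := by
      intro Γ₁ Γ₂ h₁ h₂ st
      obtain ⟨L, hL, g⟩ := two ih Γ₁ Γ₂ h₁ h₂ ρ
      exact ⟨L, hL, g.head st⟩
    match C with
    | .var p => exact absurd ⟨p, Or.inl rfl⟩ hn
    | .neg (.var p) => exact absurd ⟨p, Or.inr rfl⟩ hn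
    | .conj A B =>
      have h1 := m_insert_le A (insert B Θ)
      have h2 := m_insert_le B Θ
      simp only [size] at hs
      exact one _ (by omega) (.conj Θ A B ρ)
    | .disj A B =>
      have h1 := m_insert_le A Θ
      have h2 := m_insert_le B Θ
      simp only [size] at hs
      exact tw _ _ (by omega) (by omega) (.disj Θ A B ρ)
    | .neg (.neg A) =>
      have h1 := m_insert_le A Θ
      simp only [size] at hs
      exact one _ (by omega) (.negneg Θ A ρ)
    | .neg (.disj A B) =>
      have h1 := m_insert_le A.neg (insert B.neg Θ)
      have h2 := m_insert_le B.neg Θ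
      simp only [size] at hs h1 h2
      exact one _ (by omega) (.negdisj Θ A B ρ)
    | .neg (.conj A B) =>
      have h1 := m_insert_le A.neg Θ
      have h2 := m_insert_le B.neg Θ
      simp only [size] at hs h1 h2
      exact tw _ _ (by omega) (by omega) (.negconj Θ A B ρ)

lemma dnf (α : Datum) : ∀ ρ : Datum, ∃ L, LitD L ∧ GS (α ∪ ρ) (L ∪ ρ) := by
  induction α using Finset.induction_on with
  | empty => intro ρ; exact ⟨∅, by intro Γ h; simp at h, Relation.ReflTransGen.refl⟩
  | insert Γ α _ ih =>
    intro ρ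
    obtain ⟨L₁, hL₁, g₁⟩ := comp_dnf _ Γ (Nat.lt_succ_self _) (α ∪ ρ)
    obtain ⟨L₂, hL₂, g₂⟩ := ih (L₁ ∪ ρ)
    refine ⟨L₂ ∪ L₁, ?_, ?_⟩
    · intro Γ hΓ
      rcases Finset.mem_union.1 hΓ with h | h
      · exact hL₂ Γ h
      · exact hL₁ Γ h
    · rw [Finset.insert_union, Finset.union_assoc]
      rw [Finset.union_left_comm] at g₁
      exact g₁.trans g₂

lemma dels (f : Finset Fml → Finset Fml) (α : Datum) : (∀ Γ ∈ α, f Γ ⊆ Γ) → ∀ ρ : Datum,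
    Relation.ReflTransGen (fun x y => GStep x y ∨ DelStep x y) (α ∪ ρ) (α.image f ∪ ρ) := by
  induction α using Finset.induction_on with
  | empty => intro _ ρ; exact Relation.ReflTransGen.refl
  | insert Γ α _ ih =>
    intro hf ρ
    have g := ih (fun Δ hΔ => hf Δ (Finset.mem_insert_of_mem hΔ)) (insert (f Γ) ρ)
    rw [union_insert', union_insert'] at g
    rw [Finset.image_insert, Finset.insert_union, Finset.insert_union]
    refine g.head (Or.inr ⟨f Γ, Γ, α ∪ ρ, ?_, rfl⟩)
    rw [Finset.union_eq_right.2 (hf Γ (Finset.mem_insert_self _ _))]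

lemma exps (γ δ : Datum) :
    Relation.ReflTransGen (fun x y => GStep y x ∨ ExpStep x y) γ (δ ∪ γ) := by
  induction δ using Finset.induction_on with
  | empty => rw [Finset.empty_union]
  | insert Γ δ _ ih =>
    rw [Finset.insert_union]
    exact ih.tail (Or.inr ⟨Γ, rfl⟩)

def can : ℕ → Set (Set Fml) × Set (Set Fml) := fun p => ({{.var p}}, {{.neg (.var p)}})

def Fo (s : Set Fml) (A : Fml) : Prop := ∃ t ∈ (Sem can A).1, t ⊆ s

def FoD (s : Set Fml) (α : Datum) : Prop := ∃ Γ ∈ α, ∀ A ∈ Γ, Fo s A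

lemma ex_union (s : Set Fml) (X Y : Set (Set Fml)) :
    (∃ t ∈ {s | ∃ s₁ ∈ X, ∃ s₂ ∈ Y, s = s₁ ∪ s₂}, t ⊆ s) ↔
      (∃ t ∈ X, t ⊆ s) ∧ (∃ t ∈ Y, t ⊆ s) := by
  constructor
  · rintro ⟨_, ⟨a, ha, b, hb, rfl⟩, h⟩
    exact ⟨⟨a, ha, Set.subset_union_left.trans h⟩, ⟨b, hb, Set.subset_union_right.trans h⟩⟩
  · rintro ⟨⟨a, ha, h⟩, ⟨b, hb, h'⟩⟩
    exact ⟨_, ⟨a, ha, b, hb, rfl⟩, Set.union_subset h h'⟩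

lemma ex_or (s : Set Fml) (X Y : Set (Set Fml)) :
    (∃ t ∈ X ∪ Y, t ⊆ s) ↔ (∃ t ∈ X, t ⊆ s) ∨ (∃ t ∈ Y, t ⊆ s) := by
  simp only [Set.mem_union, or_and_right, exists_or]

lemma fo_conj (s A B) : Fo s (.conj A B) ↔ Fo s A ∧ Fo s B := ex_union s _ _
lemma fo_disj (s A B) : Fo s (.disj A B) ↔ Fo s A ∨ Fo s B := ex_or s _ _
lemma fo_nn (s A) : Fo s (.neg (.neg A)) ↔ Fo s A := Iff.rfl
lemma fo_negdisj (s A B) : Fo s (.neg (.disj A B)) ↔ Fo s (.neg A) ∧ Fo s (.neg B) :=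
  ex_union s _ _
lemma fo_negconj (s A B) : Fo s (.neg (.conj A B)) ↔ Fo s (.neg A) ∨ Fo s (.neg B) :=
  ex_or s _ _

lemma fo_lit (s A) (h : Lit A) : Fo s A ↔ A ∈ s := by
  obtain ⟨p, rfl | rfl⟩ := h <;> simp [Fo, Sem, can]

lemma fod_insert (s Γ ρ) : FoD s (insert Γ ρ) ↔ (∀ A ∈ Γ, Fo s A) ∨ FoD s ρ := by
  simp [FoD]

lemma fod_step (s : Set Fml) {α β : Datum} (h : GStep α β) : FoD s α ↔ FoD s β := by
  cases h <;>
    simp only [fod_insert, Finset.forall_mem_insert, fo_conj, fo_disj, fo_nn, fo_negdisj,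
      fo_negconj] <;> tauto

lemma fod_steps (s : Set Fml) {α β : Datum} (h : GS α β) : FoD s α ↔ FoD s β := by
  induction h with
  | refl => rfl
  | tail _ st ih => exact ih.trans (fod_step s st)

lemma can_model : IsModel can := by
  intro p h
  have : ({.var p} : Set Fml) = {.neg (.var p)} := Set.singleton_injective h
  exact Fml.noConfusion (Set.singleton_injective this)

lemma fod_of_tm {s t : Set Fml} {α : Datum} (h : t ∈ DatumTM can α) (hs : t ⊆ s) : FoD s α := by
  obtain ⟨Γ, hΓ, f, hf, rfl⟩ := h
  exact ⟨Γ, hΓ, fun A hA => ⟨f A, hf A hA, (Set.subset_biUnion_of_mem (u := f) hA).trans hs⟩⟩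

lemma tm_of_fod {s : Set Fml} {α : Datum} (h : FoD s α) : ∃ t ∈ DatumTM can α, t ⊆ s := by
  obtain ⟨Γ, hΓ, hf⟩ := h
  choose! f hf hs using hf
  exact ⟨_, ⟨Γ, hΓ, f, hf, rfl⟩, Set.iUnion₂_subset hs⟩

lemma fod_cons {α β : Datum} (h : FDEConsD α β) (s : Set Fml) (hs : FoD s α) : FoD s β := by
  obtain ⟨t, ht, hts⟩ := tm_of_fod hs
  obtain ⟨t', ht', h'⟩ := h Fml can can_model t ht
  exact fod_of_tm ht' (h'.trans hts)

end FDEAux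

open FDEAux

/-- Normal-deduction completeness of FDEDC (DC without the N-rules): if
α ⊨_FDE β then there is a deduction of β from α consisting of analytic
FDEDC-rule applications (analytic G-rules and Del) followed by synthetic
ones (synthetic G-rules and Exp). -/
theorem fdedc_normal_deduction_completeness (α β : Datum)
    (h : FDEConsD α β) :
    ∃ γ : Datum,
      Relation.ReflTransGen (fun x y => GStep x y ∨ DelStep x y) α γ ∧
      Relation.ReflTransGen (fun x y => GStep y x ∨ ExpStep x y) γ β := by
  obtain ⟨α', hα, gα⟩ := dnf α ∅
  obtain ⟨β', hβ, gβ⟩ := dnf β ∅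
  rw [Finset.union_empty, Finset.union_empty] at gα gβ
  have key : ∀ Γ ∈ α', ∃ Δ ∈ β', Δ ⊆ Γ := by
    intro Γ hΓ
    have h1 : FoD (Γ : Set Fml) α' := ⟨Γ, hΓ, fun A hA => (fo_lit _ A (hα Γ hΓ A hA)).2 hA⟩
    obtain ⟨Δ, hΔ, h2⟩ := (fod_steps _ gβ).1 (fod_cons h _ ((fod_steps _ gα).2 h1))
    exact ⟨Δ, hΔ, fun A hA => (fo_lit _ A (hβ Δ hΔ A hA)).1 (h2 A hA)⟩
  choose! f hf hs using key
  refine ⟨α'.image f, ?_, ?_⟩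
  · have := dels f α' hs ∅
    rw [Finset.union_empty, Finset.union_empty] at this
    have g' : Relation.ReflTransGen (fun x y => GStep x y ∨ DelStep x y) α α' :=
      Relation.ReflTransGen.mono (fun _ _ => Or.inl) _ _ gα
    exact g'.trans this
  · have := exps (α'.image f) β'
    rw [Finset.union_eq_left.2 (Finset.image_subset_iff.2 hf)] at this
    have g' : Relation.ReflTransGen (fun x y => GStep y x ∨ ExpStep x y) β' β :=
      Relation.ReflTransGen.mono (fun _ _ => Or.inl) _ _ (Relation.ReflTransGen.swap _ _ gβ)
    exact this.trans g'
end

section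
/- Deductive completeness of EqFDEDC: for all data α and β, if α ≃_FDE β (α ⊨_FDE β and β ⊨_FDE α) then there is an EqFDEDC-deduction of β from α. -/
/-- The SuperSet rule ↑SS: in the presence of a component Γ, add a component
of the form Γ∪Δ. (Its inverse is ↓SS.) -/
def SSAdd (α β : Datum) : Prop :=
  ∃ (Γ Δ : Finset Fml) (ρ : Datum),
    α = insert Γ ρ ∧ β = insert Γ (insert (Γ ∪ Δ) ρ)

/-- One step of EqFDEDC: G-rules in both directions together with ↑SS and ↓SS. -/
def EqFDEDCStep (α β : Datum) : Prop :=
  GStep α β ∨ GStep β α ∨ SSAdd α β ∨ SSAdd β α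

namespace EqAux

abbrev Der := Relation.ReflTransGen EqFDEDCStep

theorem step_symm {α β : Datum} (h : EqFDEDCStep α β) : EqFDEDCStep β α := by
  unfold EqFDEDCStep at *; tauto

theorem der_symm {α β : Datum} (h : Der α β) : Der β α := by
  induction h with
  | refl => exact Relation.ReflTransGen.refl
  | tail _ h ih => exact Relation.ReflTransGen.head (step_symm h) ih

def w : Fml → ℕ
  | .var _ => 1
  | .neg A => 2 * w A
  | .conj A B => w A + w B + 1
  | .disj A B => w A + w B + 1

theorem w_pos (A : Fml) : 0 < w A := by
  induction A <;> simp only [w] <;> omega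

def W (Γ : Finset Fml) : ℕ := ∑ A ∈ Γ, w A

theorem W_insert_le (A : Fml) (Γ : Finset Fml) : W (insert A Γ) ≤ w A + W Γ := by
  unfold W
  by_cases h : A ∈ Γ
  · rw [Finset.insert_eq_of_mem h]; omega
  · rw [Finset.sum_insert h]

def IsLit (A : Fml) : Prop := ∃ p, A = .var p ∨ A = .neg (.var p)

def LitD (α : Datum) : Prop := ∀ Γ ∈ α, ∀ A ∈ Γ, IsLit A

theorem LitD.union {α β : Datum} (h : LitD α) (h' : LitD β) : LitD (α ∪ β) := by
  intro Γ hΓ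
  rcases Finset.mem_union.1 hΓ with h1 | h1
  · exact h Γ h1
  · exact h' Γ h1

theorem norm_one {Γ Γ' : Finset Fml}
    (hs : ∀ ρ, EqFDEDCStep (insert Γ ρ) (insert Γ' ρ))
    (ih : ∃ N, LitD N ∧ ∀ ρ, Der (insert Γ' ρ) (N ∪ ρ)) :
    ∃ N, LitD N ∧ ∀ ρ, Der (insert Γ ρ) (N ∪ ρ) := by
  obtain ⟨N, hN, h⟩ := ih
  exact ⟨N, hN, fun ρ => Relation.ReflTransGen.head (hs ρ) (h ρ)⟩

theorem norm_two {Γ Γ₁ Γ₂ : Finset Fml}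
    (hs : ∀ ρ, EqFDEDCStep (insert Γ ρ) (insert Γ₁ (insert Γ₂ ρ)))
    (ih₁ : ∃ N, LitD N ∧ ∀ ρ, Der (insert Γ₁ ρ) (N ∪ ρ))
    (ih₂ : ∃ N, LitD N ∧ ∀ ρ, Der (insert Γ₂ ρ) (N ∪ ρ)) :
    ∃ N, LitD N ∧ ∀ ρ, Der (insert Γ ρ) (N ∪ ρ) := by
  obtain ⟨N, hN, h⟩ := ih₁
  obtain ⟨M, hM, h'⟩ := ih₂
  refine ⟨M ∪ N, hM.union hN, fun ρ => Relation.ReflTransGen.head (hs ρ) ((h _).trans ?_)⟩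
  rw [Finset.union_insert, Finset.union_assoc]
  exact h' _

theorem norm_comp (n : ℕ) : ∀ Γ : Finset Fml, W Γ < n →
    ∃ N, LitD N ∧ ∀ ρ, Der (insert Γ ρ) (N ∪ ρ) := by
  induction n with
  | zero => intro Γ h; omega
  | succ n ih =>
    intro Γ hΓ
    by_cases hl : ∀ A ∈ Γ, IsLit A
    · refine ⟨{Γ}, ?_, fun ρ => ?_⟩
      · intro Δ hΔ
        rw [Finset.mem_singleton.1 hΔ]; exact hl
      · rw [← Finset.insert_eq]
    push Not at hl
    obtain ⟨A, hA, hlit⟩ := hl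
    obtain ⟨Δ, hΔ, rfl⟩ : ∃ Δ, A ∉ Δ ∧ insert A Δ = Γ :=
      ⟨Γ.erase A, Finset.notMem_erase _ _, Finset.insert_erase hA⟩
    have hW : W (insert A Δ) = w A + W Δ := Finset.sum_insert hΔ
    rw [hW] at hΓ
    have i1 := W_insert_le
    match A, hlit with
    | .var p, hlit => exact absurd ⟨p, Or.inl rfl⟩ hlit
    | .neg (.var p), hlit => exact absurd ⟨p, Or.inr rfl⟩ hlit
    | .conj A B, _ =>
      have := i1 A (insert B Δ); have := i1 B Δ
      simp only [w] at *
      exact norm_one (fun ρ => Or.inl (.conj Δ A B ρ)) (ih _ (by omega))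
    | .disj A B, _ =>
      have := i1 A Δ; have := i1 B Δ; have := w_pos A; have := w_pos B
      simp only [w] at *
      exact norm_two (fun ρ => Or.inl (.disj Δ A B ρ)) (ih _ (by omega)) (ih _ (by omega))
    | .neg (.neg A), _ =>
      have := i1 A Δ; have := w_pos A
      simp only [w] at *
      exact norm_one (fun ρ => Or.inl (.negneg Δ A ρ)) (ih _ (by omega))
    | .neg (.disj A B), _ =>
      have := i1 A.neg (insert B.neg Δ); have := i1 B.neg Δ
      simp only [w] at *
      exact norm_one (fun ρ => Or.inl (.negdisj Δ A B ρ)) (ih _ (by omega))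
    | .neg (.conj A B), _ =>
      have := i1 A.neg Δ; have := i1 B.neg Δ; have := w_pos A; have := w_pos B
      simp only [w] at *
      exact norm_two (fun ρ => Or.inl (.negconj Δ A B ρ)) (ih _ (by omega)) (ih _ (by omega))

theorem norm_datum (α : Datum) : ∃ N, LitD N ∧ ∀ ρ, Der (α ∪ ρ) (N ∪ ρ) := by
  induction α using Finset.induction_on with
  | empty => exact ⟨∅, by intro Γ h; simp at h, fun ρ => Relation.ReflTransGen.refl⟩
  | insert Γ α _ ih =>
    obtain ⟨N, hN, h⟩ := ih
    obtain ⟨M, hM, h'⟩ := norm_comp _ Γ (Nat.lt_succ_self _)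
    refine ⟨N ∪ M, hN.union hM, fun ρ => ?_⟩
    have e1 := h' (α ∪ ρ)
    have e2 := h (M ∪ ρ)
    rw [Finset.insert_union]
    rw [Finset.union_left_comm] at e2
    rw [Finset.union_assoc]
    exact e1.trans e2

/-- Canonical model. -/
def can (p : ℕ) : Set (Set (ℕ × Bool)) × Set (Set (ℕ × Bool)) :=
  ({{(p, true)}}, {{(p, false)}})

theorem can_model : IsModel can := by
  intro p h
  simp [can] at h

def F (u : Set (ℕ × Bool)) (A : Fml) : Prop := ∃ s ∈ (Sem can A).1, s ⊆ u

theorem F_var (u) (p : ℕ) : F u (.var p) ↔ (p, true) ∈ u := by simp [F, Sem, can]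

theorem F_nvar (u) (p : ℕ) : F u (.neg (.var p)) ↔ (p, false) ∈ u := by simp [F, Sem, can]

theorem F_nn (u A) : F u (.neg (.neg A)) ↔ F u A := Iff.rfl

theorem F_conj (u A B) : F u (.conj A B) ↔ F u A ∧ F u B := by
  constructor
  · rintro ⟨s, ⟨a, ha, b, hb, rfl⟩, hs⟩
    exact ⟨⟨a, ha, (Set.union_subset_iff.1 hs).1⟩, ⟨b, hb, (Set.union_subset_iff.1 hs).2⟩⟩
  · rintro ⟨⟨a, ha, h1⟩, ⟨b, hb, h2⟩⟩
    exact ⟨_, ⟨a, ha, b, hb, rfl⟩, Set.union_subset h1 h2⟩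

theorem F_ndisj (u A B) : F u (.neg (.disj A B)) ↔ F u A.neg ∧ F u B.neg := by
  constructor
  · rintro ⟨s, ⟨a, ha, b, hb, rfl⟩, hs⟩
    exact ⟨⟨a, ha, (Set.union_subset_iff.1 hs).1⟩, ⟨b, hb, (Set.union_subset_iff.1 hs).2⟩⟩
  · rintro ⟨⟨a, ha, h1⟩, ⟨b, hb, h2⟩⟩
    exact ⟨_, ⟨a, ha, b, hb, rfl⟩, Set.union_subset h1 h2⟩

theorem F_disj (u A B) : F u (.disj A B) ↔ F u A ∨ F u B := by
  simp only [F, Sem, Set.mem_union, or_and_right, exists_or]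

theorem F_nconj (u A B) : F u (.neg (.conj A B)) ↔ F u A.neg ∨ F u B.neg := by
  simp only [F, Sem, Set.mem_union, or_and_right, exists_or]

def FD (u : Set (ℕ × Bool)) (α : Datum) : Prop := ∃ Γ ∈ α, ∀ A ∈ Γ, F u A

theorem FD_iff (u α) : FD u α ↔ ∃ s ∈ DatumTM can α, s ⊆ u := by
  constructor
  · rintro ⟨Γ, hΓ, h⟩
    have : ∀ A, ∃ s : Set (ℕ × Bool), A ∈ Γ → s ∈ (Sem can A).1 ∧ s ⊆ u := by
      intro A
      by_cases hA : A ∈ Γ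
      · obtain ⟨s, hs⟩ := h A hA
        exact ⟨s, fun _ => hs⟩
      · exact ⟨∅, fun h => absurd h hA⟩
    choose f hf using this
    exact ⟨_, ⟨Γ, hΓ, f, fun A hA => (hf A hA).1, rfl⟩,
      Set.iUnion₂_subset fun A hA => (hf A hA).2⟩
  · rintro ⟨s, ⟨Γ, hΓ, f, hf, rfl⟩, hs⟩
    exact ⟨Γ, hΓ, fun A hA => ⟨f A, hf A hA, (Set.iUnion₂_subset_iff.1 hs) A hA⟩⟩

theorem FD_insert (u Γ ρ) : FD u (insert Γ ρ) ↔ (∀ A ∈ Γ, F u A) ∨ FD u ρ := by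
  simp [FD]

theorem FD_gstep {α β : Datum} (u) (h : GStep α β) : FD u α ↔ FD u β := by
  cases h <;> simp only [FD_insert, Finset.forall_mem_insert, F_conj, F_disj, F_nn, F_ndisj,
    F_nconj] <;> tauto

theorem FD_ss {α β : Datum} (u) (h : SSAdd α β) : FD u α ↔ FD u β := by
  obtain ⟨Γ, Δ, ρ, rfl, rfl⟩ := h
  have : (∀ A ∈ Γ ∪ Δ, F u A) → ∀ A ∈ Γ, F u A :=
    fun h A hA => h A (Finset.mem_union_left _ hA)
  simp only [FD_insert]
  tauto

theorem FD_der {α β : Datum} (u) (h : Der α β) : FD u α ↔ FD u β := by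
  induction h with
  | refl => rfl
  | tail _ h ih =>
    rw [ih]
    rcases h with h | h | h | h
    · exact FD_gstep u h
    · exact (FD_gstep u h).symm
    · exact FD_ss u h
    · exact (FD_ss u h).symm

theorem FD_cons {α β : Datum} (h : FDEConsD α β) (u) (hu : FD u α) : FD u β := by
  rw [FD_iff] at *
  obtain ⟨s, hs, hsu⟩ := hu
  obtain ⟨t, ht, hts⟩ := h _ can can_model s hs
  exact ⟨t, ht, hts.trans hsu⟩

theorem lit_sub {α β : Datum} (hα : LitD α) (hβ : LitD β) (h : ∀ u, FD u α → FD u β) :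
    ∀ Γ ∈ α, ∃ Δ ∈ β, Δ ⊆ Γ := by
  intro Γ hΓ
  let u : Set (ℕ × Bool) := {x | (if x.2 then Fml.var x.1 else .neg (.var x.1)) ∈ Γ}
  have key : ∀ A, IsLit A → (F u A ↔ A ∈ Γ) := by
    rintro A ⟨p, rfl | rfl⟩
    · rw [F_var]; simp [u]
    · rw [F_nvar]; simp [u]
  obtain ⟨Δ, hΔ, hf⟩ := h u ⟨Γ, hΓ, fun A hA => (key A (hα Γ hΓ A hA)).2 hA⟩
  exact ⟨Δ, hΔ, fun A hA => (key A (hβ Δ hΔ A hA)).1 (hf A hA)⟩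

theorem add_all (α β : Datum) (h : ∀ Γ ∈ β, ∃ Δ ∈ α, Δ ⊆ Γ) : Der α (β ∪ α) := by
  induction β using Finset.induction_on with
  | empty => rw [Finset.empty_union]
  | insert Γ β _ ih =>
    refine (ih fun Γ' h' => h Γ' (Finset.mem_insert_of_mem h')).tail ?_
    obtain ⟨Δ, hΔ, hs⟩ := h Γ (Finset.mem_insert_self _ _)
    refine Or.inr (Or.inr (Or.inl ⟨Δ, Γ, β ∪ α, ?_, ?_⟩))
    · rw [Finset.insert_eq_of_mem (Finset.mem_union_right _ hΔ)]
    · rw [Finset.union_eq_right.2 hs, Finset.insert_union]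
      exact (Finset.insert_eq_of_mem
        (Finset.mem_insert_of_mem (Finset.mem_union_right _ hΔ))).symm

end EqAux

/-- Deductive completeness of EqFDEDC: if α ≃_FDE β (mutual FDE consequence)
then β is EqFDEDC-deducible from α. -/
theorem eqfdedc_deductive_completeness (α β : Datum)
    (h₁ : FDEConsD α β) (h₂ : FDEConsD β α) :
    Relation.ReflTransGen EqFDEDCStep α β := by
  obtain ⟨M, hM, h⟩ := EqAux.norm_datum α
  obtain ⟨N, hN, h'⟩ := EqAux.norm_datum β
  have hm := h ∅
  have hn := h' ∅
  simp only [Finset.union_empty] at hm hn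
  have s1 := EqAux.lit_sub hM hN fun u hu =>
    (EqAux.FD_der u hn).1 (EqAux.FD_cons h₁ u ((EqAux.FD_der u hm).2 hu))
  have s2 := EqAux.lit_sub hN hM fun u hu =>
    (EqAux.FD_der u hm).1 (EqAux.FD_cons h₂ u ((EqAux.FD_der u hn).2 hu))
  have a1 := EqAux.add_all M N s2
  have a2 := EqAux.add_all N M s1
  rw [Finset.union_comm] at a2
  exact hm.trans (a1.trans ((EqAux.der_symm a2).trans (EqAux.der_symm hn)))
end
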